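/- arXiv:2604.23751 — 3 statements merged into one kernel-verified Lean document; each statement's English description precedes it below -/
import Mathlib

section
/- For every β > 0, lim_{n→∞} (1/n)·log(Z_n^{β,321}) = (2/β)·∫_{e^{−β/2}}^{e^{β/2}} (log(1+y))/y dy. -/
open MeasureTheory Filter Set

attribute [local instance] Classical.propDecidable

noncomputable section

/-- Number of inversions of a permutation of `Fin n`. -/
def invCount {n : ℕ} (σ : Equiv.Perm (Fin n)) : ℕ :=
  (Finset.univ.filter (fun p : Fin n × Fin n => p.1 < p.2 ∧ σ p.2 < σ p.1)).card

/-- `σ` avoids the pattern `321`. -/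
def Avoids321 {n : ℕ} (σ : Equiv.Perm (Fin n)) : Prop :=
  ¬ ∃ i j k : Fin n, i < j ∧ j < k ∧ σ j < σ i ∧ σ k < σ j

/-- Partition function of the 321-avoiding Mallows model with parameter `e^{β/n}`. -/
def Z321 (β : ℝ) (n : ℕ) : ℝ :=
  ∑ σ ∈ Finset.univ.filter (fun σ : Equiv.Perm (Fin n) => Avoids321 σ),
    Real.exp (β / n * invCount σ)

theorem sum_le_sum_of_injOn_of_le {ι κ : Type*} {s : Finset ι} {t : Finset κ}
    {f : ι → ℝ} {g : κ → ℝ} (e : ι → κ) (hmem : ∀ i ∈ s, e i ∈ t)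
    (hinj : Set.InjOn e s) (hle : ∀ i ∈ s, f i ≤ g (e i)) (hg : ∀ k ∈ t, 0 ≤ g k) :
    ∑ i ∈ s, f i ≤ ∑ k ∈ t, g k := by
  calc ∑ i ∈ s, f i ≤ ∑ i ∈ s, g (e i) := Finset.sum_le_sum hle
    _ = ∑ k ∈ s.image e, g k := (Finset.sum_image hinj).symm
    _ ≤ ∑ k ∈ t, g k := Finset.sum_le_sum_of_subset_of_nonneg
        (Finset.image_subset_iff.2 hmem) (fun k hk _ => hg k hk)

/-- The partition function of 321-avoiding permutations with weight `e^{t · inv}`. -/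
def avoidSum (t : ℝ) (n : ℕ) : ℝ :=
  ∑ σ ∈ Finset.univ.filter (fun σ : Equiv.Perm (Fin n) => Avoids321 σ),
    Real.exp (t * invCount σ)

/-- The signed area `∑ B - ∑ A` of a pair of subsets of `Fin n`. -/
def area {n : ℕ} (A B : Finset (Fin n)) : ℤ :=
  ∑ b ∈ B, ((b : ℕ) : ℤ) - ∑ a ∈ A, ((a : ℕ) : ℤ)

/-- The inversions of `σ` whose left position is `i`. -/
def rightInv {n : ℕ} (σ : Equiv.Perm (Fin n)) (i : Fin n) : ℕ :=
  (Finset.univ.filter (fun j : Fin n => i < j ∧ σ j < σ i)).card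

theorem invCount_eq_sum {n : ℕ} (σ : Equiv.Perm (Fin n)) :
    invCount σ = ∑ i, rightInv σ i := by
  unfold invCount rightInv
  simp only [Finset.card_filter, Fintype.sum_prod_type]

theorem val_eq_rightInv_add {n : ℕ} (σ : Equiv.Perm (Fin n)) (i : Fin n) :
    (σ i : ℕ) = rightInv σ i +
      (Finset.univ.filter (fun j : Fin n => j < i ∧ σ j < σ i)).card := by
  have h : (Finset.univ.filter (fun j : Fin n => σ j < σ i)).card = (σ i : ℕ) := by
    rw [← Fin.card_Iio (σ i)]
    refine Finset.card_bij (fun j _ => σ j) ?_ ?_ ?_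
    · simp
    · intro a _ b _ hab
      exact σ.injective hab
    · intro b hb
      exact ⟨σ.symm b, by simpa using hb, by simp⟩
  rw [← h, rightInv, ← Finset.card_union_of_disjoint]
  · congr 1
    ext j
    simp only [Finset.mem_filter, Finset.mem_univ, true_and, Finset.mem_union]
    constructor
    · intro hj
      rcases lt_trichotomy i j with h1 | h1 | h1
      · exact Or.inl ⟨h1, hj⟩
      · subst h1
        exact absurd hj (lt_irrefl _)
      · exact Or.inr ⟨h1, hj⟩
    · rintro (h1 | h1) <;> exact h1.2
  · rw [Finset.disjoint_left]
    intro j h1 h2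
    simp only [Finset.mem_filter, Finset.mem_univ, true_and] at h1 h2
    exact lt_asymm h1.1 h2.1

theorem val_sub_le_rightInv {n : ℕ} (σ : Equiv.Perm (Fin n)) (i : Fin n) :
    ((σ i : ℕ) : ℤ) - (i : ℕ) ≤ rightInv σ i := by
  have h := val_eq_rightInv_add σ i
  have h2 : (Finset.univ.filter (fun j : Fin n => j < i ∧ σ j < σ i)).card ≤ (i : ℕ) := by
    rw [← Fin.card_Iio i]
    refine Finset.card_le_card ?_
    intro j hj
    simp only [Finset.mem_filter, Finset.mem_univ, true_and] at hj
    simpa using hj.1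
  omega

theorem area_map {n : ℕ} (σ : Equiv.Perm (Fin n)) (A : Finset (Fin n)) :
    area A (A.map σ.toEmbedding) = ∑ a ∈ A, (((σ a : ℕ) : ℤ) - (a : ℕ)) := by
  rw [area, Finset.sum_map, Finset.sum_sub_distrib]
  rfl

theorem area_map_le_invCount {n : ℕ} (σ : Equiv.Perm (Fin n)) (A : Finset (Fin n)) :
    area A (A.map σ.toEmbedding) ≤ invCount σ := by
  rw [area_map, invCount_eq_sum]
  push_cast
  calc ∑ a ∈ A, (((σ a : ℕ) : ℤ) - (a : ℕ)) ≤ ∑ a ∈ A, (rightInv σ a : ℤ) :=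
        Finset.sum_le_sum (fun a _ => val_sub_le_rightInv σ a)
    _ ≤ ∑ a, (rightInv σ a : ℤ) :=
        Finset.sum_le_sum_of_subset_of_nonneg (Finset.subset_univ _)
          (fun _ _ _ => Int.natCast_nonneg _)

/-- The positions of the left-to-right maxima of `σ`. -/
def records {n : ℕ} (σ : Equiv.Perm (Fin n)) : Finset (Fin n) :=
  Finset.univ.filter (fun i => ∀ j < i, σ j < σ i)

theorem mem_records {n : ℕ} {σ : Equiv.Perm (Fin n)} {i : Fin n} :
    i ∈ records σ ↔ ∀ j < i, σ j < σ i := by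
  simp [records]

theorem exists_of_notMem_records {n : ℕ} {σ : Equiv.Perm (Fin n)} {i : Fin n}
    (hi : i ∉ records σ) : ∃ j < i, σ i < σ j := by
  rw [mem_records] at hi
  push Not at hi
  obtain ⟨j, hj, h⟩ := hi
  exact ⟨j, hj, lt_of_le_of_ne h (fun e => hj.ne (σ.injective e).symm)⟩

theorem strictMonoOn_records {n : ℕ} (σ : Equiv.Perm (Fin n)) :
    StrictMonoOn σ (records σ : Set (Fin n)) := by
  intro i _ j hj hij
  exact mem_records.1 (Finset.mem_coe.1 hj) i hij

theorem strictMonoOn_compl_records {n : ℕ} {σ : Equiv.Perm (Fin n)} (h : Avoids321 σ) :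
    StrictMonoOn σ (records σ : Set (Fin n))ᶜ := by
  intro i hi j _ hij
  obtain ⟨k, hk, hki⟩ := exists_of_notMem_records (σ := σ) (i := i) (by simpa using hi)
  by_contra hlt
  have hne : σ i ≠ σ j := fun e => hij.ne (σ.injective e)
  exact h ⟨k, i, j, hk, hij, hki, lt_of_le_of_ne (not_lt.1 hlt) hne.symm⟩

theorem invCount_eq_area {n : ℕ} {σ : Equiv.Perm (Fin n)} (h : Avoids321 σ) :
    (invCount σ : ℤ) = area (records σ) ((records σ).map σ.toEmbedding) := by
  rw [area_map, invCount_eq_sum]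
  push_cast
  rw [← Finset.sum_subset (Finset.subset_univ (records σ))]
  · refine Finset.sum_congr rfl (fun i hi => ?_)
    have h1 := val_eq_rightInv_add σ i
    have h2 : (Finset.univ.filter (fun j : Fin n => j < i ∧ σ j < σ i)).card = (i : ℕ) := by
      rw [← Fin.card_Iio i]
      congr 1
      ext j
      simp only [Finset.mem_filter, Finset.mem_univ, true_and, Finset.mem_Iio]
      exact ⟨fun hj => hj.1, fun hj => ⟨hj, mem_records.1 hi j hj⟩⟩
    omega
  · intro i _ hi
    obtain ⟨k, hk, hki⟩ := exists_of_notMem_records hi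
    norm_cast
    rw [rightInv, Finset.card_eq_zero, Finset.filter_eq_empty_iff]
    rintro j - ⟨hij, hj⟩
    exact h ⟨k, i, j, hk, hij, hki, hj⟩

theorem eqOn_of_strictMonoOn_of_image_eq {α β : Type*} [LinearOrder α] [WellFoundedLT α]
    [PartialOrder β] {f g : α → β} {s : Set α} (hf : StrictMonoOn f s)
    (hg : StrictMonoOn g s) (h : f '' s = g '' s) : Set.EqOn f g s := by
  have hf' : StrictMono (s.domRestrict f) := strictMono_domRestrict.2 hf
  have hg' : StrictMono (s.domRestrict g) := strictMono_domRestrict.2 hg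
  have key := (StrictMono.range_inj hf' hg').1 (by simpa only [Set.range_domRestrict] using h)
  intro x hx
  exact congrFun key ⟨x, hx⟩

theorem perm_eq_of_strictMonoOn {n : ℕ} {σ τ : Equiv.Perm (Fin n)} {A : Finset (Fin n)}
    (hσ : StrictMonoOn σ (A : Set (Fin n))) (hσ' : StrictMonoOn σ (A : Set (Fin n))ᶜ)
    (hτ : StrictMonoOn τ (A : Set (Fin n))) (hτ' : StrictMonoOn τ (A : Set (Fin n))ᶜ)
    (h : A.map σ.toEmbedding = A.map τ.toEmbedding) : σ = τ := by
  have h1 : σ '' (A : Set (Fin n)) = τ '' (A : Set (Fin n)) := by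
    have := congrArg (fun s : Finset (Fin n) => (s : Set (Fin n))) h
    simpa using this
  have h2 : σ '' (A : Set (Fin n))ᶜ = τ '' (A : Set (Fin n))ᶜ := by
    rw [Set.image_compl_eq σ.bijective, Set.image_compl_eq τ.bijective, h1]
  ext i
  congr 1
  by_cases hi : i ∈ (A : Set (Fin n))
  · exact eqOn_of_strictMonoOn_of_image_eq hσ hτ h1 hi
  · exact eqOn_of_strictMonoOn_of_image_eq hσ' hτ' h2 hi

theorem exists_perm_strictMonoOn {n : ℕ} {A B : Finset (Fin n)} (h : A.card = B.card) :
    ∃ σ : Equiv.Perm (Fin n), A.map σ.toEmbedding = B ∧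
      StrictMonoOn σ (A : Set (Fin n)) ∧ StrictMonoOn σ (A : Set (Fin n))ᶜ := by
  have hc : Aᶜ.card = Bᶜ.card := by rw [Finset.card_compl, Finset.card_compl, h]
  let e : A ≃o B := (A.orderIsoOfFin h).symm.trans (B.orderIsoOfFin rfl)
  let f : (Aᶜ : Finset (Fin n)) ≃o (Bᶜ : Finset (Fin n)) :=
    (Aᶜ.orderIsoOfFin hc).symm.trans (Bᶜ.orderIsoOfFin rfl)
  let f' : {x // ¬ x ∈ A} ≃ {x // ¬ x ∈ B} :=
    ((Equiv.subtypeEquivRight (by simp)).trans f.toEquiv).trans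
      (Equiv.subtypeEquivRight (by simp))
  let σ : Equiv.Perm (Fin n) := Equiv.subtypeCongr (p := (· ∈ A)) (q := (· ∈ B)) e.toEquiv f'
  have hσ1 : ∀ (i : Fin n) (hi : i ∈ A), σ i = e ⟨i, hi⟩ := by
    intro i hi
    simp [σ, Equiv.subtypeCongr, hi]
  have hσ2 : ∀ (i : Fin n) (hi : i ∉ A), σ i = f ⟨i, by simpa using hi⟩ := by
    intro i hi
    simp [σ, Equiv.subtypeCongr, hi, f']
    rfl
  refine ⟨σ, ?_, ?_, ?_⟩
  · refine Finset.eq_of_subset_of_card_le ?_ (by simp [h])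
    intro b hb
    obtain ⟨a, ha, rfl⟩ := Finset.mem_map.1 hb
    change σ a ∈ B
    rw [hσ1 a ha]
    exact (e ⟨a, ha⟩).2
  · intro i hi j hj hij
    rw [hσ1 i hi, hσ1 j hj]
    exact e.strictMono (a := ⟨i, hi⟩) (b := ⟨j, hj⟩) hij
  · intro i hi j hj hij
    rw [hσ2 i hi, hσ2 j hj]
    exact f.strictMono (a := ⟨i, by simpa using hi⟩) (b := ⟨j, by simpa using hj⟩) hij

theorem avoids321_of_strictMonoOn {n : ℕ} {σ : Equiv.Perm (Fin n)} {A : Finset (Fin n)}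
    (h : StrictMonoOn σ (A : Set (Fin n))) (h' : StrictMonoOn σ (A : Set (Fin n))ᶜ) :
    Avoids321 σ := by
  rintro ⟨i, j, k, hij, hjk, h1, h2⟩
  have key : ∀ x y : Fin n, x < y → σ y < σ x → (x ∈ A ↔ y ∉ A) := by
    intro x y hxy hlt
    by_cases hx : x ∈ A <;> by_cases hy : y ∈ A
    · exact absurd (h hx hy hxy) (lt_asymm hlt)
    · simp [hx, hy]
    · simp [hx, hy]
    · exact absurd (h' (by simpa using hx) (by simpa using hy) hxy) (lt_asymm hlt)
  have a1 := key i j hij h1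
  have a2 := key j k hjk h2
  have a3 := key i k (hij.trans hjk) (h2.trans h1)
  tauto

/-- The number of elements of `A` below `m`. -/
def countBelow {n : ℕ} (A : Finset (Fin n)) (m : ℕ) : ℕ :=
  (A.filter (fun i : Fin n => (i : ℕ) < m)).card

/-- Strict domination of `B` by `A`: the path of the pair `(A, B)` is positive inside. -/
structure Dominates {n : ℕ} (A B : Finset (Fin n)) : Prop where
  card_eq : A.card = B.card
  le : ∀ m, countBelow B m ≤ countBelow A m
  lt_of_mem : ∀ i ∈ A, countBelow B (i + 1) < countBelow A (i + 1)

theorem countBelow_succ_of_mem {n : ℕ} {A : Finset (Fin n)} {i : Fin n} (hi : i ∈ A) :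
    countBelow A (i + 1) = countBelow A i + 1 := by
  have h : A.filter (fun j : Fin n => (j : ℕ) < (i : ℕ) + 1) =
      insert i (A.filter (fun j : Fin n => (j : ℕ) < (i : ℕ))) := by
    ext j
    simp only [Finset.mem_filter, Finset.mem_insert, Fin.ext_iff]
    constructor
    · rintro ⟨h1, h2⟩
      rcases Nat.lt_succ_iff_lt_or_eq.1 h2 with h3 | h3
      · exact Or.inr ⟨h1, h3⟩
      · exact Or.inl h3
    · rintro (h1 | h1)
      · exact ⟨by rwa [Fin.ext h1], by omega⟩
      · exact ⟨h1.1, by omega⟩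
  rw [countBelow, h, Finset.card_insert_of_notMem (by simp), countBelow]

theorem countBelow_mono {n : ℕ} (A : Finset (Fin n)) : Monotone (countBelow A) := by
  intro a b hab
  refine Finset.card_le_card ?_
  intro i hi
  simp only [Finset.mem_filter] at hi ⊢
  exact ⟨hi.1, hi.2.trans_le hab⟩

theorem countBelow_map {n : ℕ} {σ : Equiv.Perm (Fin n)} {A : Finset (Fin n)}
    (h : StrictMonoOn σ (A : Set (Fin n))) {i : Fin n} (hi : i ∈ A) :
    countBelow (A.map σ.toEmbedding) (σ i) = countBelow A i := by
  rw [countBelow, Finset.filter_map, Finset.card_map, countBelow]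
  congr 1
  refine Finset.filter_congr (fun j hj => ?_)
  exact h.lt_iff_lt hj hi

theorem countBelow_compl {n : ℕ} (A : Finset (Fin n)) {m : ℕ} (hm : m ≤ n) :
    countBelow A m + countBelow Aᶜ m = m := by
  have h : countBelow (Finset.univ : Finset (Fin n)) m = m := by
    rw [countBelow, Finset.card_filter, Fin.sum_univ_eq_sum_range (fun i => if i < m then 1 else 0),
      ← Finset.card_filter]
    have : (Finset.range n).filter (· < m) = Finset.range m := by
      ext j
      simp only [Finset.mem_filter, Finset.mem_range]
      omega
    rw [this, Finset.card_range]
  refine Eq.trans ?_ h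
  rw [countBelow, countBelow, countBelow, ← Finset.card_union_of_disjoint,
    ← Finset.filter_union, Finset.union_compl]
  exact Finset.disjoint_filter_filter disjoint_compl_right

theorem mem_iff_lt_of_dominates {n : ℕ} {σ : Equiv.Perm (Fin n)} {A : Finset (Fin n)}
    (hd : Dominates A (A.map σ.toEmbedding))
    (h : StrictMonoOn σ (A : Set (Fin n))) (h' : StrictMonoOn σ (A : Set (Fin n))ᶜ)
    (i : Fin n) : i ∈ A ↔ i < σ i := by
  constructor
  · intro hi
    by_contra hlt
    have h1 := countBelow_map h hi
    have h2 := hd.lt_of_mem i hi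
    have h3 : countBelow (A.map σ.toEmbedding) (σ i + 1) =
        countBelow (A.map σ.toEmbedding) (σ i) + 1 :=
      countBelow_succ_of_mem (Finset.mem_map_of_mem σ.toEmbedding hi)
    have h4 := countBelow_succ_of_mem hi
    have h5 := countBelow_mono (A.map σ.toEmbedding)
      (show (σ i : ℕ) + 1 ≤ (i : ℕ) + 1 by simpa using hlt)
    omega
  · intro hlt
    by_contra hi
    have hi' : i ∈ Aᶜ := by simpa using hi
    have hc : (A.map σ.toEmbedding)ᶜ = Aᶜ.map σ.toEmbedding := by
      ext j
      simp [Finset.mem_map_equiv]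
    have h1 := countBelow_map (A := Aᶜ) (σ := σ) (by simpa using h') hi'
    have h2 := countBelow_mono (Aᶜ.map σ.toEmbedding)
      (show (i : ℕ) + 1 ≤ (σ i : ℕ) from hlt)
    have h3 := countBelow_succ_of_mem hi'
    have h4 := countBelow_compl A (m := i + 1) i.2
    have h5 := countBelow_compl (A.map σ.toEmbedding) (m := i + 1) i.2
    rw [hc] at h5
    have h6 := hd.le (i + 1)
    omega

theorem sum_dominates_le_avoidSum {t : ℝ} (ht : 0 ≤ t) (n : ℕ) :
    ∑ p ∈ Finset.univ.filter (fun p : Finset (Fin n) × Finset (Fin n) => Dominates p.1 p.2),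
      Real.exp (t * area p.1 p.2) ≤ avoidSum t n := by
  have hex : ∀ p : Finset (Fin n) × Finset (Fin n), ∃ σ : Equiv.Perm (Fin n),
      Dominates p.1 p.2 → p.1.map σ.toEmbedding = p.2 ∧
      StrictMonoOn σ (p.1 : Set (Fin n)) ∧ StrictMonoOn σ (p.1 : Set (Fin n))ᶜ := by
    intro p
    by_cases hp : Dominates p.1 p.2
    · obtain ⟨σ, hσ⟩ := exists_perm_strictMonoOn hp.card_eq
      exact ⟨σ, fun _ => hσ⟩
    · exact ⟨1, fun h => absurd h hp⟩
  choose e he using hex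
  refine sum_le_sum_of_injOn_of_le e ?_ ?_ ?_ (fun _ _ => (Real.exp_pos _).le)
  · intro p hp
    obtain ⟨-, h2, h3⟩ := he p (by simpa using hp)
    simpa using avoids321_of_strictMonoOn h2 h3
  · rintro ⟨A, B⟩ hp ⟨A', B'⟩ hp' heq
    have hd : Dominates A B := by simpa using hp
    have hd' : Dominates A' B' := by simpa using hp'
    obtain ⟨h1, h2, h3⟩ := he (A, B) hd
    obtain ⟨h1', h2', h3'⟩ := he (A', B') hd'
    dsimp only at h1 h2 h3 h1' h2' h3'
    have hA : A = A' := by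
      ext i
      rw [mem_iff_lt_of_dominates (by rwa [h1]) h2 h3,
        mem_iff_lt_of_dominates (by rwa [h1']) h2' h3', heq]
    subst hA
    rw [← h1, ← h1', heq]
  · rintro ⟨A, B⟩ hp
    obtain ⟨h1, -, -⟩ := he (A, B) (by simpa using hp)
    dsimp only at h1
    have h := area_map_le_invCount (e (A, B)) A
    rw [h1] at h
    refine Real.exp_le_exp.2 (mul_le_mul_of_nonneg_left ?_ ht)
    exact_mod_cast h

/-- The embedding of `Fin n` into the middle of `Fin (n + 2)`. -/
def middleEmb (n : ℕ) : Fin n ↪ Fin (n + 2) :=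
  ⟨fun i => i.castSucc.succ, fun i j h => by simpa using h⟩

theorem val_middleEmb {n : ℕ} (i : Fin n) : (middleEmb n i : ℕ) = i + 1 := rfl

/-- Insert a first point below a set. -/
def padLeft {n : ℕ} (A : Finset (Fin n)) : Finset (Fin (n + 2)) :=
  insert 0 (A.map (middleEmb n))

/-- Insert a last point above a set. -/
def padRight {n : ℕ} (B : Finset (Fin n)) : Finset (Fin (n + 2)) :=
  insert (Fin.last (n + 1)) (B.map (middleEmb n))

theorem zero_notMem_map_middleEmb {n : ℕ} (A : Finset (Fin n)) : 0 ∉ A.map (middleEmb n) := by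
  intro h
  obtain ⟨a, -, ha⟩ := Finset.mem_map.1 h
  have := congrArg Fin.val ha
  simp [val_middleEmb] at this

theorem last_notMem_map_middleEmb {n : ℕ} (A : Finset (Fin n)) :
    Fin.last (n + 1) ∉ A.map (middleEmb n) := by
  intro h
  obtain ⟨a, -, ha⟩ := Finset.mem_map.1 h
  have := congrArg Fin.val ha
  simp only [val_middleEmb, Fin.val_last] at this
  omega

theorem padLeft_injective {n : ℕ} : Function.Injective (padLeft (n := n)) := by
  intro A A' h
  have h2 := congrArg (fun s => s.erase 0) h
  simp only [padLeft, Finset.erase_insert (zero_notMem_map_middleEmb _)] at h2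
  exact Finset.map_injective _ h2

theorem padRight_injective {n : ℕ} : Function.Injective (padRight (n := n)) := by
  intro A A' h
  have h2 := congrArg (fun s => s.erase (Fin.last (n + 1))) h
  simp only [padRight, Finset.erase_insert (last_notMem_map_middleEmb _)] at h2
  exact Finset.map_injective _ h2

theorem area_pad {n : ℕ} {A B : Finset (Fin n)} (h : A.card = B.card) :
    area (padLeft A) (padRight B) = area A B + (n + 1) := by
  unfold area padLeft padRight
  rw [Finset.sum_insert (zero_notMem_map_middleEmb _),
    Finset.sum_insert (last_notMem_map_middleEmb _), Finset.sum_map, Finset.sum_map]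
  simp only [val_middleEmb, Fin.val_last]
  push_cast
  rw [Finset.sum_add_distrib, Finset.sum_add_distrib]
  simp [h]
  ring

theorem countBelow_map_middleEmb {n : ℕ} (A : Finset (Fin n)) (m : ℕ) :
    countBelow (A.map (middleEmb n)) (m + 1) = countBelow A m := by
  rw [countBelow, Finset.filter_map, Finset.card_map, countBelow]
  congr 1
  refine Finset.filter_congr (fun j _ => ?_)
  simp [val_middleEmb]

theorem countBelow_padLeft {n : ℕ} (A : Finset (Fin n)) (m : ℕ) :
    countBelow (padLeft A) (m + 1) = countBelow A m + 1 := by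
  rw [← countBelow_map_middleEmb A m, countBelow, padLeft, Finset.filter_insert,
    if_pos (by simp), Finset.card_insert_of_notMem, countBelow]
  intro h
  exact zero_notMem_map_middleEmb A (Finset.mem_filter.1 h).1

theorem countBelow_padRight {n : ℕ} (A : Finset (Fin n)) (m : ℕ) :
    countBelow (padRight A) (m + 1) = countBelow A m + if n + 1 ≤ m then 1 else 0 := by
  rw [← countBelow_map_middleEmb A m, countBelow, padRight, Finset.filter_insert]
  by_cases hm : n + 1 ≤ m
  · rw [if_pos (by simpa using (show n + 1 < m + 1 by omega)), if_pos hm,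
      Finset.card_insert_of_notMem, countBelow]
    intro h
    exact last_notMem_map_middleEmb A (Finset.mem_filter.1 h).1
  · rw [if_neg (by simpa using (show m ≤ n by omega)), if_neg hm, countBelow, add_zero]

theorem dominates_pad {n : ℕ} {A B : Finset (Fin n)} (h : A.card = B.card)
    (hle : ∀ m, countBelow B m ≤ countBelow A m) :
    Dominates (padLeft A) (padRight B) := by
  refine ⟨?_, ?_, ?_⟩
  · rw [padLeft, padRight, Finset.card_insert_of_notMem (zero_notMem_map_middleEmb _),
      Finset.card_insert_of_notMem (last_notMem_map_middleEmb _)]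
    simp [h]
  · rintro (_ | m)
    · simp [countBelow]
    · rw [countBelow_padLeft, countBelow_padRight]
      have := hle m
      split_ifs <;> omega
  · intro i hi
    rw [countBelow_padLeft, countBelow_padRight, if_neg, add_zero]
    · exact Nat.lt_succ_of_le (hle i)
    · rcases Finset.mem_insert.1 hi with rfl | hi
      · simp
      · obtain ⟨a, -, rfl⟩ := Finset.mem_map.1 hi
        have := a.2
        rw [val_middleEmb]
        omega

theorem countBelow_succ {n : ℕ} [NeZero n] (A : Finset (Fin n)) {m : ℕ} (hm : m < n) :
    countBelow A (m + 1) = countBelow A m + if Fin.ofNat n m ∈ A then 1 else 0 := by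
  have hval : ((Fin.ofNat n m : Fin n) : ℕ) = m := by simp [Nat.mod_eq_of_lt hm]
  by_cases h : Fin.ofNat n m ∈ A
  · have := countBelow_succ_of_mem h
    rw [hval] at this
    rw [this, if_pos h]
  · rw [if_neg h, add_zero, countBelow, countBelow]
    congr 1
    refine Finset.filter_congr (fun j hj => ?_)
    have hne : (j : ℕ) ≠ m := by
      intro e
      apply h
      have : Fin.ofNat n m = j := Fin.ext (by rw [hval, e])
      rwa [this]
    omega

/-- The step at time `k` of the periodic path of a pair of sets. -/
def pathStep {n : ℕ} [NeZero n] (A B : Finset (Fin n)) (k : ℕ) : ℤ :=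
  (if Fin.ofNat n k ∈ A then 1 else 0) - (if Fin.ofNat n k ∈ B then 1 else 0)

theorem sum_pathStep {n : ℕ} [NeZero n] (A B : Finset (Fin n)) {m : ℕ} (hm : m ≤ n) :
    ∑ j ∈ Finset.range m, pathStep A B j = (countBelow A m : ℤ) - countBelow B m := by
  induction m with
  | zero => simp [countBelow]
  | succ m ih =>
    rw [Finset.sum_range_succ, ih (by omega), countBelow_succ A (by omega),
      countBelow_succ B (by omega), pathStep]
    push_cast
    ring

theorem countBelow_of_le {n : ℕ} (A : Finset (Fin n)) {m : ℕ} (hm : n ≤ m) :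
    countBelow A m = A.card := by
  rw [countBelow, Finset.filter_true_of_mem]
  intro i _
  exact i.2.trans_le hm

theorem sum_val_eq {n : ℕ} [NeZero n] (A : Finset (Fin n)) :
    ∑ a ∈ A, ((a : ℕ) : ℤ) =
      ∑ j ∈ Finset.range n, (j : ℤ) * (if Fin.ofNat n j ∈ A then 1 else 0) := by
  rw [← Fin.sum_univ_eq_sum_range (fun j : ℕ => (j : ℤ) * (if Fin.ofNat n j ∈ A then 1 else 0))]
  simp [Finset.sum_ite_mem]

theorem sum_range_sum_range (s : ℕ → ℤ) (N : ℕ) :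
    ∑ m ∈ Finset.range N, ∑ j ∈ Finset.range m, s j =
      (N - 1) * ∑ j ∈ Finset.range N, s j - ∑ j ∈ Finset.range N, j * s j := by
  induction N with
  | zero => simp
  | succ N ih =>
    rw [Finset.sum_range_succ, ih, Finset.sum_range_succ, Finset.sum_range_succ]
    push_cast
    ring

theorem area_eq_sum {n : ℕ} [NeZero n] {A B : Finset (Fin n)} (h : A.card = B.card) :
    area A B = ∑ m ∈ Finset.range n, ∑ j ∈ Finset.range m, pathStep A B j := by
  rw [sum_range_sum_range, sum_pathStep A B le_rfl, countBelow_of_le A le_rfl,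
    countBelow_of_le B le_rfl, h, area, sum_val_eq, sum_val_eq, sub_self, mul_zero, zero_sub,
    ← Finset.sum_sub_distrib, ← Finset.sum_neg_distrib]
  refine Finset.sum_congr rfl (fun j _ => ?_)
  rw [pathStep]
  ring

/-- Cyclic rotation of a subset of `Fin n`. -/
def rotateSet {n : ℕ} [NeZero n] (r : Fin n) (A : Finset (Fin n)) : Finset (Fin n) :=
  A.map (Equiv.subRight r).toEmbedding

theorem mem_rotateSet {n : ℕ} [NeZero n] {r i : Fin n} {A : Finset (Fin n)} :
    i ∈ rotateSet r A ↔ i + r ∈ A := by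
  rw [rotateSet, Finset.mem_map_equiv]
  rfl

theorem pathStep_rotateSet {n : ℕ} [NeZero n] (r : Fin n) (A B : Finset (Fin n)) (k : ℕ) :
    pathStep (rotateSet r A) (rotateSet r B) k = pathStep A B (r + k) := by
  have : Fin.ofNat n k + r = Fin.ofNat n (r + k) := by
    ext
    simp [Fin.val_add, add_comm]
  simp only [pathStep, mem_rotateSet, this]

theorem sum_range_add_of_periodic {f : ℕ → ℤ} {n : ℕ} (hf : ∀ k, f (n + k) = f k) (r : ℕ) :
    ∑ m ∈ Finset.range n, f (r + m) = ∑ m ∈ Finset.range n, f m := by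
  induction r with
  | zero => simp
  | succ r ih =>
    have h1 := Finset.sum_range_succ (fun m => f (r + m)) n
    have h2 := Finset.sum_range_succ' (fun m => f (r + m)) n
    have h3 : ∀ m, f (r + (m + 1)) = f (r + 1 + m) := fun m => by congr 1; ring
    simp only [h3, add_zero] at h2
    have h4 := hf r
    rw [add_comm] at h4
    linarith

theorem exists_rotateSet {n : ℕ} [NeZero n] {A B : Finset (Fin n)} (h : A.card = B.card) :
    ∃ r : Fin n, (∀ m, countBelow (rotateSet r B) m ≤ countBelow (rotateSet r A) m) ∧
      area A B ≤ area (rotateSet r A) (rotateSet r B) := by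
  set T : ℕ → ℤ := fun m => ∑ j ∈ Finset.range m, pathStep A B j with hT
  have hTn : T n = 0 := by
    rw [hT]
    simp only
    rw [sum_pathStep A B le_rfl, countBelow_of_le A le_rfl, countBelow_of_le B le_rfl, h, sub_self]
  have hadd : ∀ a b, T (a + b) = T a + ∑ j ∈ Finset.range b, pathStep A B (a + j) := fun a b =>
    Finset.sum_range_add _ a b
  have hper : ∀ k, T (n + k) = T k := by
    intro k
    rw [hadd, hTn, zero_add]
    refine Finset.sum_congr rfl (fun j _ => ?_)
    have : Fin.ofNat n (n + j) = Fin.ofNat n j := by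
      ext
      simp
    simp only [pathStep, this]
  have hmod : ∀ k, T k = T (k % n) := by
    intro k
    induction k using Nat.strong_induction_on with
    | _ k ih =>
      by_cases hk : k < n
      · rw [Nat.mod_eq_of_lt hk]
      · obtain ⟨l, rfl⟩ := Nat.exists_eq_add_of_le (not_lt.1 hk)
        have := NeZero.pos n
        rw [hper, ih l (by omega), Nat.add_mod_left]
  obtain ⟨r, -, hr⟩ := Finset.exists_min_image (Finset.univ : Finset (Fin n))
    (fun i => T i) ⟨0, Finset.mem_univ _⟩
  have hmin : ∀ k, T r ≤ T k := by
    intro k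
    rw [hmod k]
    exact hr ⟨k % n, Nat.mod_lt _ (NeZero.pos n)⟩ (Finset.mem_univ _)
  have hrot : ∀ m, ∑ j ∈ Finset.range m, pathStep (rotateSet r A) (rotateSet r B) j =
      T (r + m) - T r := by
    intro m
    rw [hadd]
    simp only [pathStep_rotateSet]
    ring
  have hcard : (rotateSet r A).card = (rotateSet r B).card := by
    rw [rotateSet, rotateSet, Finset.card_map, Finset.card_map, h]
  refine ⟨r, fun m => ?_, ?_⟩
  · rcases le_total m n with hm | hm
    · have h1 := sum_pathStep (rotateSet r A) (rotateSet r B) hm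
      rw [hrot] at h1
      have := hmin (r + m)
      omega
    · rw [countBelow_of_le _ hm, countBelow_of_le _ hm, hcard]
  · rw [area_eq_sum h, area_eq_sum hcard]
    simp only [hrot]
    rw [Finset.sum_sub_distrib, sum_range_add_of_periodic hper]
    have h0 : T r ≤ 0 := by simpa [hT] using hmin 0
    have : (n : ℤ) * T r ≤ 0 := mul_nonpos_of_nonneg_of_nonpos (by positivity) h0
    rw [Finset.sum_const, Finset.card_range, nsmul_eq_mul]
    exact le_sub_self_iff _ |>.2 this

theorem sum_card_eq_le_mul_avoidSum {t : ℝ} (ht : 0 ≤ t) (n : ℕ) [NeZero n] :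
    ∑ p ∈ Finset.univ.filter (fun p : Finset (Fin n) × Finset (Fin n) => p.1.card = p.2.card),
      Real.exp (t * area p.1 p.2) ≤ n * avoidSum t (n + 2) := by
  let good : Finset (Fin n) × Finset (Fin n) → Prop := fun p =>
    ∀ m, countBelow p.2 m ≤ countBelow p.1 m
  let rot : Fin n → Finset (Fin n) × Finset (Fin n) → Finset (Fin n) × Finset (Fin n) :=
    fun r p => (rotateSet r p.1, rotateSet r p.2)
  have hrot : ∀ r : Fin n, ∑ p ∈ Finset.univ.filter
      (fun p : Finset (Fin n) × Finset (Fin n) => p.1.card = p.2.card),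
      (if good (rot r p) then Real.exp (t * area (rot r p).1 (rot r p).2) else 0) ≤
        avoidSum t (n + 2) := by
    intro r
    rw [← Finset.sum_filter]
    refine le_trans ?_ (sum_dominates_le_avoidSum ht (n + 2))
    have hcard : ∀ p : Finset (Fin n) × Finset (Fin n), p.1.card = p.2.card →
        (rot r p).1.card = (rot r p).2.card := by
      intro p hp
      simp only [rot, rotateSet, Finset.card_map, hp]
    refine sum_le_sum_of_injOn_of_le
      (fun p => (padLeft (rot r p).1, padRight (rot r p).2)) ?_ ?_ ?_
      (fun _ _ => (Real.exp_pos _).le)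
    · intro p hp
      simp only [Finset.mem_filter, Finset.mem_univ, true_and] at hp ⊢
      exact dominates_pad (hcard p hp.1) hp.2
    · rintro ⟨A, B⟩ - ⟨A', B'⟩ - heq
      simp only [Prod.mk.injEq, rot] at heq ⊢
      exact ⟨Finset.map_injective _ (padLeft_injective heq.1),
        Finset.map_injective _ (padRight_injective heq.2)⟩
    · intro p hp
      simp only [Finset.mem_filter, Finset.mem_univ, true_and] at hp
      refine Real.exp_le_exp.2 (mul_le_mul_of_nonneg_left ?_ ht)
      rw [area_pad (hcard p hp.1)]
      push_cast
      linarith [(Nat.cast_nonneg n : (0 : ℝ) ≤ n)]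
  calc ∑ p ∈ Finset.univ.filter
        (fun p : Finset (Fin n) × Finset (Fin n) => p.1.card = p.2.card),
        Real.exp (t * area p.1 p.2)
      ≤ ∑ p ∈ Finset.univ.filter
        (fun p : Finset (Fin n) × Finset (Fin n) => p.1.card = p.2.card), ∑ r : Fin n,
        (if good (rot r p) then Real.exp (t * area (rot r p).1 (rot r p).2) else 0) := by
        refine Finset.sum_le_sum (fun p hp => ?_)
        obtain ⟨r, hr1, hr2⟩ := exists_rotateSet (Finset.mem_filter.1 hp).2
        refine le_trans ?_ (Finset.single_le_sum (fun r _ => ?_) (Finset.mem_univ r))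
        · rw [if_pos (show good (rot r p) from hr1)]
          refine Real.exp_le_exp.2 (mul_le_mul_of_nonneg_left ?_ ht)
          exact_mod_cast hr2
        · split_ifs
          · exact (Real.exp_pos _).le
          · exact le_rfl
    _ ≤ ∑ r : Fin n, avoidSum t (n + 2) := by
        rw [Finset.sum_comm]
        exact Finset.sum_le_sum (fun r _ => hrot r)
    _ = n * avoidSum t (n + 2) := by simp

/-- The product `∏ᵢ (1 + e^{t (i - (n-1)/2)})`. -/
def centeredProd (t : ℝ) (n : ℕ) : ℝ :=
  ∏ i : Fin n, (1 + Real.exp (t * ((i : ℕ) - ((n : ℝ) - 1) / 2)))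

/-- The sum of a subset of `Fin n`, centered at the midpoint. -/
def centeredSum {n : ℕ} (A : Finset (Fin n)) : ℝ :=
  ∑ a ∈ A, (((a : ℕ) : ℝ) - ((n : ℝ) - 1) / 2)

theorem centeredProd_eq_sum (t : ℝ) (n : ℕ) :
    centeredProd t n = ∑ A : Finset (Fin n), Real.exp (t * centeredSum A) := by
  rw [centeredProd, Finset.prod_one_add, Finset.powerset_univ]
  refine Finset.sum_congr rfl (fun A _ => ?_)
  rw [centeredSum, Finset.mul_sum, Real.exp_sum]

theorem centeredSum_map_rev {n : ℕ} (A : Finset (Fin n)) :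
    centeredSum (A.map Fin.revPerm.toEmbedding) = -centeredSum A := by
  rw [centeredSum, Finset.sum_map, centeredSum, ← Finset.sum_neg_distrib]
  refine Finset.sum_congr rfl (fun a _ => ?_)
  have := a.2
  simp only [Equiv.coe_toEmbedding, Fin.revPerm_apply, Fin.val_rev]
  rw [Nat.cast_sub (by omega)]
  push_cast
  ring

theorem area_eq_centeredSum {n : ℕ} {A B : Finset (Fin n)} (h : A.card = B.card) :
    (area A B : ℝ) = centeredSum B - centeredSum A := by
  simp only [area, centeredSum, Finset.sum_sub_distrib, Finset.sum_const, h]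
  push_cast
  ring

theorem avoidSum_le (t : ℝ) (n : ℕ) : avoidSum t n ≤ centeredProd t n ^ 2 := by
  rw [sq, centeredProd_eq_sum, Finset.sum_mul_sum, ← Finset.sum_product', Finset.univ_product_univ]
  refine sum_le_sum_of_injOn_of_le (fun σ : Equiv.Perm (Fin n) =>
    ((records σ).map Fin.revPerm.toEmbedding, (records σ).map σ.toEmbedding))
    (fun _ _ => Finset.mem_univ _) ?_ ?_ (fun _ _ => by positivity)
  · intro σ hσ τ hτ h
    simp only [Prod.mk.injEq] at h
    have hσ' : Avoids321 σ := by simpa using hσ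
    have hτ' : Avoids321 τ := by simpa using hτ
    have hrec := Finset.map_injective _ h.1
    have h2 := h.2
    rw [← hrec] at h2
    refine perm_eq_of_strictMonoOn (strictMonoOn_records σ)
      (strictMonoOn_compl_records hσ') ?_ ?_ h2
    · rw [hrec]
      exact strictMonoOn_records τ
    · rw [hrec]
      exact strictMonoOn_compl_records hτ'
  · intro σ hσ
    have h := invCount_eq_area (σ := σ) (by simpa using hσ)
    have h2 : (invCount σ : ℝ) = (area (records σ) ((records σ).map σ.toEmbedding) : ℝ) := by
      exact_mod_cast h
    rw [h2, area_eq_centeredSum (by simp), ← Real.exp_add, centeredSum_map_rev]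
    apply le_of_eq
    congr 1
    ring

theorem centeredProd_sq_le {t : ℝ} (n : ℕ) :
    centeredProd t n ^ 2 ≤ (n + 1) * ∑ p ∈ Finset.univ.filter
      (fun p : Finset (Fin n) × Finset (Fin n) => p.1.card = p.2.card),
        Real.exp (t * area p.1 p.2) := by
  let f : ℕ → ℝ := fun k => ∑ A ∈ Finset.univ.filter (fun A : Finset (Fin n) => A.card = k),
    Real.exp (t * centeredSum A)
  have hf : ∀ k, f k = ∑ A ∈ Finset.univ.filter (fun A : Finset (Fin n) => A.card = k),
      Real.exp (-(t * centeredSum A)) := by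
    intro k
    refine Finset.sum_bij' (fun A _ => A.map Fin.revPerm.toEmbedding)
      (fun A _ => A.map Fin.revPerm.toEmbedding) ?_ ?_ ?_ ?_ ?_
    · simp
    · simp
    · intro A _
      ext i
      simp [Finset.mem_map_equiv]
    · intro A _
      ext i
      simp [Finset.mem_map_equiv]
    · intro A _
      rw [centeredSum_map_rev]
      congr 1
      ring
  have hmaps : ∀ A : Finset (Fin n), A ∈ Finset.univ → A.card ∈ Finset.range (n + 1) := by
    intro A _
    have := Finset.card_le_univ A
    rw [Fintype.card_fin] at this
    exact Finset.mem_range.2 (by omega)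
  have h1 : centeredProd t n = ∑ k ∈ Finset.range (n + 1), f k := by
    rw [centeredProd_eq_sum, ← Finset.sum_fiberwise_of_maps_to hmaps]
  have h2 : ∑ p ∈ Finset.univ.filter
      (fun p : Finset (Fin n) × Finset (Fin n) => p.1.card = p.2.card),
        Real.exp (t * area p.1 p.2) = ∑ k ∈ Finset.range (n + 1), f k ^ 2 := by
    rw [← Finset.sum_fiberwise_of_maps_to (g := fun p => p.1.card) (t := Finset.range (n + 1))
      (fun p _ => hmaps p.1 (Finset.mem_univ _))]
    refine Finset.sum_congr rfl (fun k _ => ?_)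
    rw [sq]
    nth_rewrite 1 [hf k]
    rw [Finset.sum_mul_sum, ← Finset.sum_product']
    refine Finset.sum_congr ?_ ?_
    · ext p
      simp only [Finset.mem_filter, Finset.mem_univ, true_and, Finset.mem_product]
      constructor
      · rintro ⟨a, b⟩
        exact ⟨b, a ▸ b⟩
      · rintro ⟨a, b⟩
        exact ⟨a.trans b.symm, a⟩
    · intro p hp
      simp only [Finset.mem_filter, Finset.mem_univ, true_and, Finset.mem_product] at hp
      rw [area_eq_centeredSum (hp.1.trans hp.2.symm), ← Real.exp_add]
      congr 1
      ring
  rw [h1, h2]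
  simpa using sq_sum_le_card_mul_sum_sq (s := Finset.range (n + 1)) (f := f)

theorem centeredProd_sq_le_avoidSum {t : ℝ} (ht : 0 ≤ t) (n : ℕ) [NeZero n] :
    centeredProd t n ^ 2 ≤ (n + 1) * (n * avoidSum t (n + 2)) :=
  (centeredProd_sq_le n).trans
    (mul_le_mul_of_nonneg_left (sum_card_eq_le_mul_avoidSum ht n) (by positivity))

theorem centeredProd_add_two_le {t b : ℝ} (n : ℕ) (hb : t * (n + 2) ≤ b) (ht : 0 ≤ t) :
    centeredProd t (n + 2) ≤ (1 + Real.exp b) ^ 2 * centeredProd t n := by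
  have hfac : ∀ x : ℝ, x ≤ n + 2 → 1 + Real.exp (t * x) ≤ 1 + Real.exp b := by
    intro x hx
    have := mul_le_mul_of_nonneg_left hx ht
    gcongr
    linarith
  have hpos : ∀ x : ℝ, 0 ≤ 1 + Real.exp x := fun x => by positivity
  have hmid : ∏ i : Fin n,
      (1 + Real.exp (t * ((i.castSucc.succ : ℕ) - (((n + 2 : ℕ) : ℝ) - 1) / 2))) =
      centeredProd t n := by
    refine Finset.prod_congr rfl (fun i _ => ?_)
    congr 3
    simp only [Fin.val_succ, Fin.val_castSucc]
    push_cast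
    ring
  have hn : (0 : ℝ) ≤ n := Nat.cast_nonneg n
  have h0 : 0 ≤ centeredProd t n := Finset.prod_nonneg (fun i _ => hpos _)
  rw [centeredProd, Fin.prod_univ_succ, Fin.prod_univ_castSucc, hmid]
  calc _ ≤ (1 + Real.exp b) * (centeredProd t n * (1 + Real.exp b)) := by
        refine mul_le_mul (hfac _ ?_) (mul_le_mul_of_nonneg_left (hfac _ ?_) h0)
          (mul_nonneg h0 (hpos _)) (hpos _)
        · simp
          linarith
        · simp
          linarith
    _ = _ := by ring

theorem monotone_log_one_add_exp : Monotone (fun x : ℝ => Real.log (1 + Real.exp x)) := by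
  intro x y hxy
  exact Real.log_le_log (by positivity) (by gcongr)

theorem integral_log_one_add_div (β : ℝ) :
    ∫ y in Real.exp (-β / 2)..Real.exp (β / 2), Real.log (1 + y) / y =
      ∫ x in (-β / 2)..(β / 2), Real.log (1 + Real.exp x) := by
  rw [← intervalIntegral.integral_comp_mul_deriv' (f := Real.exp) (f' := Real.exp)
    (fun x _ => Real.hasDerivAt_exp x) Real.continuous_exp.continuousOn]
  · refine intervalIntegral.integral_congr (fun x _ => ?_)
    simp only [Function.comp]
    rw [div_mul_cancel₀ _ (Real.exp_pos x).ne']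
  · rintro y ⟨x, -, rfl⟩
    have h := Real.exp_pos x
    have h1 : (1 : ℝ) + id (Real.exp x) ≠ 0 := (add_pos one_pos h).ne'
    exact (((continuousAt_const.add continuousAt_id).log h1).div continuousAt_id
      h.ne').continuousWithinAt

theorem abs_log_centeredProd_sub_le {β : ℝ} (hβ : 0 < β) {n : ℕ} (hn : 0 < n) :
    |Real.log (centeredProd (β / n) n) -
      n / β * ∫ x in (-β / 2)..(β / 2), Real.log (1 + Real.exp x)| ≤
      Real.log (1 + Real.exp (β / 2)) - Real.log (1 + Real.exp (-β / 2)) := by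
  have hn' : (0 : ℝ) < n := by exact_mod_cast hn
  set h : ℝ → ℝ := fun x => Real.log (1 + Real.exp x) with hh
  have hmono : Monotone h := monotone_log_one_add_exp
  set g : ℝ → ℝ := fun x => h (β / n * x + -β / 2) with hg
  have hgm : Monotone g := by
    intro x y hxy
    apply hmono
    have := mul_le_mul_of_nonneg_left hxy (show 0 ≤ β / n by positivity)
    linarith
  have hint : ∫ x in (0 : ℝ)..(0 + n), g x = n / β * ∫ x in (-β / 2)..(β / 2), h x := by
    rw [hg, intervalIntegral.integral_comp_mul_add _ (by positivity)]
    have e1 : β / n * 0 + -β / 2 = -β / 2 := by ring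
    have e2 : β / n * (0 + n) + -β / 2 = β / 2 := by
      field_simp
      ring
    rw [e1, e2, inv_div, smul_eq_mul]
  have hlog : Real.log (centeredProd (β / n) n) = ∑ i ∈ Finset.range n, g (i + 1 / 2) := by
    rw [centeredProd, Real.log_prod (fun i _ => by positivity),
      ← Fin.sum_univ_eq_sum_range (fun i : ℕ => g (i + 1 / 2))]
    refine Finset.sum_congr rfl (fun i _ => ?_)
    simp only [hg, hh]
    congr 3
    field_simp
    ring
  have hlow := (hgm.monotoneOn (Set.Icc 0 (0 + n))).sum_le_integral
  have hupp := (hgm.monotoneOn (Set.Icc 0 (0 + n))).integral_le_sum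
  rw [hint] at hlow hupp
  have hs := Finset.sum_range_succ (fun i : ℕ => g (0 + i)) n
  rw [Finset.sum_range_succ'] at hs
  have hm1 : ∑ i ∈ Finset.range n, g (0 + i) ≤ ∑ i ∈ Finset.range n, g (i + 1 / 2) :=
    Finset.sum_le_sum (fun i _ => hgm (by linarith))
  have hm2 : ∑ i ∈ Finset.range n, g (i + 1 / 2) ≤
      ∑ i ∈ Finset.range n, g (0 + (i + 1 : ℕ)) :=
    Finset.sum_le_sum (fun i _ => hgm (by push_cast; linarith))
  have hg0 : g (0 + (0 : ℕ)) = Real.log (1 + Real.exp (-β / 2)) := by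
    simp [hg, hh]
  have hgn : g (0 + n) = Real.log (1 + Real.exp (β / 2)) := by
    simp only [hg, hh]
    congr 3
    field_simp
    ring
  rw [hg0, hgn] at hs
  rw [hlog, abs_le]
  constructor <;> linarith

theorem centeredProd_pos (t : ℝ) (n : ℕ) : 0 < centeredProd t n :=
  Finset.prod_pos (fun i _ => by positivity)

theorem log_Z321_le {β : ℝ} (n : ℕ) (hZ : 0 < Z321 β n) :
    Real.log (Z321 β n) ≤ 2 * Real.log (centeredProd (β / n) n) := by
  have h := Real.log_le_log hZ (avoidSum_le (β / n) n)
  rwa [Real.log_pow] at h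

theorem le_Z321 {β : ℝ} (hβ : 0 < β) (n : ℕ) [NeZero n] :
    0 < Z321 β (n + 2) ∧
    2 * Real.log (centeredProd (β / (n + 2 : ℕ)) (n + 2)) - 4 * Real.log (1 + Real.exp β) -
      2 * Real.log ((n + 2 : ℕ) : ℝ) ≤ Real.log (Z321 β (n + 2)) := by
  set t : ℝ := β / (n + 2 : ℕ) with ht
  have ht0 : 0 ≤ t := by positivity
  have hn : (0 : ℝ) < n := by exact_mod_cast NeZero.pos n
  have htb : t * (n + 2) ≤ β := by
    rw [ht]
    push_cast
    rw [div_mul_cancel₀ _ (by positivity)]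
  have h1 := centeredProd_add_two_le n htb ht0
  have h2 := centeredProd_sq_le_avoidSum ht0 n
  have hZ : Z321 β (n + 2) = avoidSum t (n + 2) := rfl
  have hp := centeredProd_pos t n
  have hpos : 0 < Z321 β (n + 2) := by
    rw [hZ]
    by_contra hle
    have h3 : ((n : ℝ) + 1) * (n * avoidSum t (n + 2)) ≤ 0 :=
      mul_nonpos_of_nonneg_of_nonpos (by positivity)
        (mul_nonpos_of_nonneg_of_nonpos hn.le (not_lt.1 hle))
    have : 0 < centeredProd t n ^ 2 := by positivity
    linarith
  refine ⟨hpos, ?_⟩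
  have h3 : centeredProd t n ^ 2 ≤ ((n + 2 : ℕ) : ℝ) ^ 2 * Z321 β (n + 2) := by
    refine h2.trans ?_
    rw [← hZ, ← mul_assoc]
    refine mul_le_mul_of_nonneg_right ?_ hpos.le
    push_cast
    nlinarith
  have h4 := Real.log_le_log (centeredProd_pos t (n + 2)) h1
  have h5 := Real.log_le_log (by positivity) h3
  rw [Real.log_mul (by positivity) (by positivity), Real.log_pow] at h4 h5
  rw [Real.log_pow] at h5
  push_cast at h4 h5 ⊢
  linarith

/-- Asymptotics of the partition function of the 321-avoiding Mallows model. -/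
theorem partition_asymptotics_321 (β : ℝ) (hβ : 0 < β) :
    Filter.Tendsto (fun n : ℕ => Real.log (Z321 β n) / n) Filter.atTop
      (nhds ((2 / β) * ∫ y in Real.exp (-β / 2)..Real.exp (β / 2),
        Real.log (1 + y) / y)) := by
  rw [integral_log_one_add_div]
  set I : ℝ := ∫ x in (-β / 2)..(β / 2), Real.log (1 + Real.exp x)
  set C : ℝ := Real.log (1 + Real.exp (β / 2)) - Real.log (1 + Real.exp (-β / 2))
  set D : ℝ := Real.log (1 + Real.exp β)
  have hlogn : Tendsto (fun n : ℕ => Real.log (n : ℝ) / n) atTop (nhds 0) :=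
    Real.isLittleO_log_id_atTop.tendsto_div_nhds_zero.comp tendsto_natCast_atTop_atTop
  have hconst : ∀ c : ℝ, Tendsto (fun n : ℕ => c / (n : ℝ)) atTop (nhds 0) :=
    fun c => tendsto_const_div_atTop_nhds_zero_nat c
  have hlow : Tendsto (fun n : ℕ => 2 / β * I - (2 * C + 4 * D) / n - 2 * (Real.log n / n))
      atTop (nhds (2 / β * I)) := by
    simpa using (tendsto_const_nhds.sub (hconst (2 * C + 4 * D))).sub (hlogn.const_mul 2)
  have hupp : Tendsto (fun n : ℕ => 2 / β * I + 2 * C / n) atTop (nhds (2 / β * I)) := by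
    simpa using tendsto_const_nhds.add (hconst (2 * C))
  have hbound : ∀ n : ℕ, 3 ≤ n →
      2 / β * I - (2 * C + 4 * D) / n - 2 * (Real.log n / n) ≤ Real.log (Z321 β n) / n ∧
      Real.log (Z321 β n) / n ≤ 2 / β * I + 2 * C / n := by
    intro n hn
    obtain ⟨m, rfl⟩ := Nat.exists_eq_add_of_le' (show 2 ≤ n by omega)
    have : NeZero m := ⟨by omega⟩
    obtain ⟨hpos, hl⟩ := le_Z321 hβ m
    have hu := log_Z321_le (m + 2) hpos
    have habs := abs_le.1 (abs_log_centeredProd_sub_le hβ (show 0 < m + 2 by omega))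
    generalize m + 2 = N at *
    have hN : (0 : ℝ) < N := by
      have : 0 < N := by omega
      exact_mod_cast this
    have e1 : 2 / β * I - (2 * C + 4 * D) / N - 2 * (Real.log N / N) =
        (2 * (N / β * I) - 2 * C - 4 * D - 2 * Real.log N) / N := by
      field_simp
      ring
    have e2 : 2 / β * I + 2 * C / N = (2 * (N / β * I) + 2 * C) / N := by
      field_simp
    rw [e1, e2]
    constructor
    · exact div_le_div_of_nonneg_right (by linarith [habs.1]) hN.le
    · exact div_le_div_of_nonneg_right (by linarith [habs.2]) hN.le
  refine tendsto_of_tendsto_of_tendsto_of_le_of_le' hlow hupp ?_ ?_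
  · filter_upwards [eventually_ge_atTop 3] with n hn using (hbound n hn).1
  · filter_upwards [eventually_ge_atTop 3] with n hn using (hbound n hn).2

end
end

section
/- For every β ≤ 0, lim_{n→∞} (1/n)·log(Z_n^{β,231}) = log 4 and lim_{n→∞} (1/n)·log(Z_n^{β,321}) = log 4. -/
open MeasureTheory Filter Set

attribute [local instance] Classical.propDecidable

noncomputable section

/-- `σ` avoids the pattern `231`. -/
def Avoids231 {n : ℕ} (σ : Equiv.Perm (Fin n)) : Prop :=
  ¬ ∃ i j k : Fin n, i < j ∧ j < k ∧ σ k < σ i ∧ σ i < σ j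

/-- Partition function of the 231-avoiding Mallows model with parameter `e^{β/n}`. -/
def Z231 (β : ℝ) (n : ℕ) : ℝ :=
  ∑ σ ∈ Finset.univ.filter (fun σ : Equiv.Perm (Fin n) => Avoids231 σ),
    Real.exp (β / n * invCount σ)

/-- Positions of the right-to-left minima of `σ`. -/
def rlMinPositions {n : ℕ} (σ : Equiv.Perm (Fin n)) : Finset (Fin n) :=
  Finset.univ.filter fun i => ∀ j, i < j → σ i < σ j

/-- Positions and values of the right-to-left minima of `σ`. -/
def rlMinData {n : ℕ} (σ : Equiv.Perm (Fin n)) : Finset (Fin n) × Finset (Fin n) :=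
  (rlMinPositions σ, (rlMinPositions σ).image σ)

lemma mem_rlMinPositions {n : ℕ} {σ : Equiv.Perm (Fin n)} {i : Fin n} :
    i ∈ rlMinPositions σ ↔ ∀ j, i < j → σ i < σ j := by
  simp [rlMinPositions]

lemma rlMinPositions_eq_of_data_eq {n : ℕ} {σ τ : Equiv.Perm (Fin n)}
    (h : rlMinData σ = rlMinData τ) : rlMinPositions σ = rlMinPositions τ :=
  congrArg Prod.fst h

lemma eq_on_rlMinPositions {n : ℕ} {σ τ : Equiv.Perm (Fin n)}
    (h : rlMinData σ = rlMinData τ) {i : Fin n} (hi : i ∈ rlMinPositions σ) : σ i = τ i := by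
  have hP := rlMinPositions_eq_of_data_eq h
  have hV : (rlMinPositions σ).image σ = (rlMinPositions σ).image τ := by
    have := congrArg Prod.snd h
    simpa [rlMinData, ← hP] using this
  have hσ : StrictMono fun x : rlMinPositions σ => σ x := fun x y hxy =>
    mem_rlMinPositions.1 x.2 y hxy
  have hτ : StrictMono fun x : rlMinPositions σ => τ x := fun x y hxy =>
    mem_rlMinPositions.1 ((Finset.ext_iff.1 hP x).1 x.2) y hxy
  have hr : Set.range (fun x : rlMinPositions σ => σ x) =
      Set.range (fun x : rlMinPositions σ => τ x) := by
    ext v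
    have := Finset.ext_iff.1 hV v
    simpa using this
  exact congrFun ((StrictMono.range_inj hσ hτ).1 hr) ⟨i, hi⟩

/-- Two distinct permutations with the same right-to-left minima last differ at a position that is
not a right-to-left minimum. -/
lemma exists_last_difference {n : ℕ} {σ τ : Equiv.Perm (Fin n)}
    (h : rlMinData σ = rlMinData τ) (hne : σ ≠ τ) :
    ∃ i k : Fin n, i < k ∧ σ i ≠ τ i ∧ (∀ j, i < j → σ j = τ j) ∧ σ k < σ i ∧ τ k < τ i := by
  have hne' : (Finset.univ.filter fun i => σ i ≠ τ i).Nonempty := by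
    by_contra hcon
    refine hne (Equiv.ext fun i => ?_)
    by_contra hi
    exact hcon ⟨i, by simpa using hi⟩
  obtain ⟨i, hi, hmax⟩ := Finset.exists_max_image _ (fun i => i) hne'
  have hi' : σ i ≠ τ i := by simpa using hi
  have heq : ∀ j, i < j → σ j = τ j := by
    intro j hj
    by_contra hcon
    exact absurd (hmax j (by simpa using hcon)) (not_le.2 hj)
  have hσ : i ∉ rlMinPositions σ := fun hm => hi' (eq_on_rlMinPositions h hm)
  have hτ : i ∉ rlMinPositions τ := rlMinPositions_eq_of_data_eq h ▸ hσ
  rw [mem_rlMinPositions] at hσ hτ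
  push Not at hσ hτ
  obtain ⟨k, hk, hk'⟩ := hσ
  obtain ⟨l, hl, hl'⟩ := hτ
  have hkne : σ k ≠ σ i := fun e => hk.ne' (σ.injective e)
  have hlne : τ l ≠ τ i := fun e => hl.ne' (τ.injective e)
  have hk2 : σ k < σ i := lt_of_le_of_ne hk' hkne
  have hl2 : τ l < τ i := lt_of_le_of_ne hl' hlne
  rcases le_total (σ k) (σ l) with hkl | hkl
  · exact ⟨i, k, hk, hi', heq, hk2, by
      rw [← heq k hk]; rw [← heq l hl] at hl2; exact hkl.trans_lt hl2⟩
  · exact ⟨i, l, hl, hi', heq, hkl.trans_lt hk2, hl2⟩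

lemma exists_earlier_preimage {n : ℕ} {σ τ : Equiv.Perm (Fin n)} {i : Fin n}
    (hi : σ i ≠ τ i) (heq : ∀ j, i < j → σ j = τ j) : ∃ j, j < i ∧ τ j = σ i := by
  refine ⟨τ.symm (σ i), ?_, by simp⟩
  by_contra hcon
  rcases (not_lt.1 hcon).eq_or_lt with h | h
  · exact hi (by rw [Equiv.eq_symm_apply] at h; exact h.symm)
  · have h2 := heq _ h
    rw [Equiv.apply_symm_apply] at h2
    exact h.ne' (σ.injective h2)

lemma rlMinData_injOn_avoids231 (n : ℕ) :
    Set.InjOn rlMinData {σ : Equiv.Perm (Fin n) | Avoids231 σ} := by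
  intro σ hσ τ hτ h
  by_contra hne
  obtain ⟨i, k, hik, hi, heq, hσk, hτk⟩ := exists_last_difference h hne
  rcases hi.lt_or_gt with hlt | hlt
  · obtain ⟨j, hj, hj'⟩ := exists_earlier_preimage hi heq
    exact hτ ⟨j, i, k, hj, hik, by rw [hj', ← heq k hik]; exact hσk, by rw [hj']; exact hlt⟩
  · obtain ⟨j, hj, hj'⟩ := exists_earlier_preimage hi.symm fun j hj => (heq j hj).symm
    exact hσ ⟨j, i, k, hj, hik, by rw [hj', heq k hik]; exact hτk, by rw [hj']; exact hlt⟩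

lemma rlMinData_injOn_avoids321 (n : ℕ) :
    Set.InjOn rlMinData {σ : Equiv.Perm (Fin n) | Avoids321 σ} := by
  intro σ hσ τ hτ h
  by_contra hne
  obtain ⟨i, k, hik, hi, heq, hσk, hτk⟩ := exists_last_difference h hne
  rcases hi.lt_or_gt with hlt | hlt
  · obtain ⟨j, hj, hj'⟩ := exists_earlier_preimage hi.symm fun j hj => (heq j hj).symm
    exact hσ ⟨j, i, k, hj, hik, by rw [hj']; exact hlt, hσk⟩
  · obtain ⟨j, hj, hj'⟩ := exists_earlier_preimage hi heq
    exact hτ ⟨j, i, k, hj, hik, by rw [hj']; exact hlt, hτk⟩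

/-- Swapping two entries that both have a common smaller entry to their right preserves the
right-to-left minima. -/
lemma rlMinData_mul_swap {n : ℕ} {σ : Equiv.Perm (Fin n)} {j i k : Fin n}
    (hji : j < i) (hik : i < k) (hj : σ k < σ j) (hi : σ k < σ i) :
    rlMinData (σ * Equiv.swap j i) = rlMinData σ := by
  have hval : ∀ p, p ≠ j → p ≠ i → (σ * Equiv.swap j i) p = σ p := fun p h1 h2 => by
    simp [Equiv.swap_apply_of_ne_of_ne h1 h2]
  have hvj : (σ * Equiv.swap j i) j = σ i := by simp
  have hvi : (σ * Equiv.swap j i) i = σ j := by simp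
  have hvk := hval k (hji.trans hik).ne' hik.ne'
  generalize σ * Equiv.swap j i = τ at *
  have hjm : j ∉ rlMinPositions σ := fun h =>
    lt_asymm hj (mem_rlMinPositions.1 h k (hji.trans hik))
  have him : i ∉ rlMinPositions σ := fun h => lt_asymm hi (mem_rlMinPositions.1 h k hik)
  have hP : rlMinPositions τ = rlMinPositions σ := by
    ext p
    rw [mem_rlMinPositions, mem_rlMinPositions]
    by_cases hpj : p = j
    · subst hpj
      grind
    by_cases hpi : p = i
    · subst hpi
      grind
    rw [hval p hpj hpi]
    constructor
    · intro h q hq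
      by_cases hqj : q = j
      · subst hqj; exact hvi ▸ h i (hq.trans hji)
      by_cases hqi : q = i
      · subst hqi; exact (hvk ▸ h k (hq.trans hik)).trans hi
      exact hval q hqj hqi ▸ h q hq
    · intro h q hq
      by_cases hqj : q = j
      · subst hqj; rw [hvj]; exact h i (hq.trans hji)
      by_cases hqi : q = i
      · subst hqi; rw [hvi]; exact (h k (hq.trans hik)).trans hj
      rw [hval q hqj hqi]; exact h q hq
  refine Prod.ext hP ?_
  change (rlMinPositions τ).image τ = (rlMinPositions σ).image σ
  rw [hP]
  refine Finset.image_congr fun p hp => hval p ?_ ?_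
  · rintro rfl; exact hjm hp
  · rintro rfl; exact him hp

lemma sum_mul_lt_sum_mul_swap {n : ℕ} {σ : Equiv.Perm (Fin n)} {j i : Fin n}
    (hji : j < i) (hσ : σ i < σ j) :
    ∑ x : Fin n, ((x : ℕ) : ℤ) * (σ x : ℕ) <
      ∑ x : Fin n, ((x : ℕ) : ℤ) * ((σ * Equiv.swap j i) x : ℕ) := by
  rw [← sub_pos, ← Finset.sum_sub_distrib, Fintype.sum_eq_add j i hji.ne]
  · simp only [Equiv.Perm.coe_mul, Function.comp_apply, Equiv.swap_apply_left,
      Equiv.swap_apply_right]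
    have h1 : ((j : ℕ) : ℤ) < (i : ℕ) := by exact_mod_cast hji
    have h2 : ((σ i : ℕ) : ℤ) < (σ j : ℕ) := by exact_mod_cast hσ
    nlinarith
  · rintro x ⟨h1, h2⟩
    simp [Equiv.swap_apply_of_ne_of_ne h1 h2]

lemma exists_avoids321_rlMinData_eq {n : ℕ} (σ : Equiv.Perm (Fin n)) :
    ∃ τ : Equiv.Perm (Fin n), Avoids321 τ ∧ rlMinData τ = rlMinData σ := by
  obtain ⟨τ, hτ, hmax⟩ := Finset.exists_max_image
    (Finset.univ.filter fun τ : Equiv.Perm (Fin n) => rlMinData τ = rlMinData σ)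
    (fun τ => ∑ x : Fin n, ((x : ℕ) : ℤ) * (τ x : ℕ)) ⟨σ, by simp⟩
  rw [Finset.mem_filter] at hτ
  refine ⟨τ, ?_, hτ.2⟩
  rintro ⟨j, i, k, hji, hik, hij, hki⟩
  refine absurd (hmax (τ * Equiv.swap j i) ?_) (not_le.2 (sum_mul_lt_sum_mul_swap hji hij))
  rw [Finset.mem_filter]
  exact ⟨Finset.mem_univ _, (rlMinData_mul_swap hji hik (hki.trans hij) hki).trans hτ.2⟩

/-- Number of permutations of `Fin n` in the class `A`. -/
def classCard (A : ∀ n : ℕ, Equiv.Perm (Fin n) → Prop) (n : ℕ) : ℕ :=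
  (Finset.univ.filter fun σ : Equiv.Perm (Fin n) => A n σ).card

lemma classCard_avoids231_le_avoids321 (n : ℕ) :
    classCard (fun _ => Avoids231) n ≤ classCard (fun _ => Avoids321) n := by
  choose f hf hf' using fun σ : Equiv.Perm (Fin n) => exists_avoids321_rlMinData_eq σ
  refine Finset.card_le_card_of_injOn f (fun σ _ => by simpa using hf σ) ?_
  intro σ hσ τ hτ h
  refine rlMinData_injOn_avoids231 n (by simpa using hσ) (by simpa using hτ) ?_
  rw [← hf' σ, ← hf' τ, h]

lemma classCard_le_four_pow {A : ∀ n : ℕ, Equiv.Perm (Fin n) → Prop} {n : ℕ}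
    (hA : Set.InjOn rlMinData {σ : Equiv.Perm (Fin n) | A n σ}) : classCard A n ≤ 4 ^ n := by
  have h : classCard A n ≤ (Finset.univ : Finset (Finset (Fin n) × Finset (Fin n))).card :=
    Finset.card_le_card_of_injOn rlMinData (fun σ _ => by simp)
      (fun σ hσ τ hτ h => hA (by simpa using hσ) (by simpa using hτ) h)
  refine h.trans_eq ?_
  rw [Finset.card_univ, Fintype.card_prod, Fintype.card_finset, Fintype.card_fin, ← mul_pow]
  norm_num

/-- The direct sum of two permutations. -/
def directSum {a b : ℕ} (σ : Equiv.Perm (Fin a)) (τ : Equiv.Perm (Fin b)) :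
    Equiv.Perm (Fin (a + b)) :=
  finSumFinEquiv.permCongr (Equiv.Perm.sumCongr σ τ)

@[simp] lemma directSum_castAdd {a b : ℕ} (σ : Equiv.Perm (Fin a)) (τ : Equiv.Perm (Fin b))
    (i : Fin a) : directSum σ τ (Fin.castAdd b i) = Fin.castAdd b (σ i) := by
  simp [directSum, Equiv.permCongr_apply]

@[simp] lemma directSum_natAdd {a b : ℕ} (σ : Equiv.Perm (Fin a)) (τ : Equiv.Perm (Fin b))
    (i : Fin b) : directSum σ τ (Fin.natAdd a i) = Fin.natAdd a (τ i) := by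
  simp [directSum, Equiv.permCongr_apply]

lemma directSum_injective {a b : ℕ} :
    Function.Injective fun p : Equiv.Perm (Fin a) × Equiv.Perm (Fin b) => directSum p.1 p.2 := by
  rintro ⟨σ, τ⟩ ⟨σ', τ'⟩ h
  have h' : ∀ x, directSum σ τ x = directSum σ' τ' x := fun x => Equiv.congr_fun h x
  refine Prod.ext (Equiv.ext fun i => ?_) (Equiv.ext fun i => ?_)
  · simpa using h' (Fin.castAdd b i)
  · simpa using h' (Fin.natAdd a i)

lemma invCount_directSum_le {a b : ℕ} (σ : Equiv.Perm (Fin a)) (τ : Equiv.Perm (Fin b)) :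
    invCount (directSum σ τ) ≤ invCount σ + invCount τ := by
  unfold invCount
  refine (Finset.card_le_card (t := Finset.image (Prod.map (Fin.castAdd b) (Fin.castAdd b))
    (Finset.univ.filter fun p : Fin a × Fin a => p.1 < p.2 ∧ σ p.2 < σ p.1) ∪
    Finset.image (Prod.map (Fin.natAdd a) (Fin.natAdd a))
    (Finset.univ.filter fun p : Fin b × Fin b => p.1 < p.2 ∧ τ p.2 < τ p.1)) ?_).trans
    ((Finset.card_union_le _ _).trans (add_le_add Finset.card_image_le Finset.card_image_le))
  rintro ⟨x, y⟩ h
  rw [Finset.mem_filter] at h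
  obtain ⟨-, h1, h2⟩ := h
  rw [Finset.mem_union, Finset.mem_image, Finset.mem_image]
  induction x using Fin.addCases <;> induction y using Fin.addCases <;>
    simp only [directSum_castAdd, directSum_natAdd, Fin.lt_def, Fin.val_castAdd,
      Fin.val_natAdd] at h1 h2
  · rename_i x y
    exact Or.inl ⟨(x, y), Finset.mem_filter.2 ⟨Finset.mem_univ _, h1, h2⟩, rfl⟩
  · omega
  · omega
  · rename_i x y
    exact Or.inr ⟨(x, y), Finset.mem_filter.2 ⟨Finset.mem_univ _, Nat.lt_of_add_lt_add_left h1,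
      Nat.lt_of_add_lt_add_left h2⟩, rfl⟩

lemma Avoids231.directSum {a b : ℕ} {σ : Equiv.Perm (Fin a)} {τ : Equiv.Perm (Fin b)}
    (hσ : Avoids231 σ) (hτ : Avoids231 τ) : Avoids231 (directSum σ τ) := by
  rintro ⟨i, j, k, h1, h2, h3, h4⟩
  induction i using Fin.addCases <;> induction j using Fin.addCases <;>
    induction k using Fin.addCases <;>
    simp only [directSum_castAdd, directSum_natAdd, Fin.lt_def, Fin.val_castAdd,
      Fin.val_natAdd] at h1 h2 h3 h4 <;> try omega
  · exact hσ ⟨_, _, _, h1, h2, h3, h4⟩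
  · rename_i i j k
    exact hτ ⟨i, j, k, Fin.lt_def.2 (by omega), Fin.lt_def.2 (by omega),
      Fin.lt_def.2 (by omega), Fin.lt_def.2 (by omega)⟩

lemma Avoids321.directSum {a b : ℕ} {σ : Equiv.Perm (Fin a)} {τ : Equiv.Perm (Fin b)}
    (hσ : Avoids321 σ) (hτ : Avoids321 τ) : Avoids321 (directSum σ τ) := by
  rintro ⟨i, j, k, h1, h2, h3, h4⟩
  induction i using Fin.addCases <;> induction j using Fin.addCases <;>
    induction k using Fin.addCases <;>
    simp only [directSum_castAdd, directSum_natAdd, Fin.lt_def, Fin.val_castAdd,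
      Fin.val_natAdd] at h1 h2 h3 h4 <;> try omega
  · exact hσ ⟨_, _, _, h1, h2, h3, h4⟩
  · rename_i i j k
    exact hτ ⟨i, j, k, Fin.lt_def.2 (by omega), Fin.lt_def.2 (by omega),
      Fin.lt_def.2 (by omega), Fin.lt_def.2 (by omega)⟩

/-- The permutation obtained from `σ` by putting a new maximum in front. -/
def consMax {b : ℕ} (σ : Equiv.Perm (Fin b)) : Equiv.Perm (Fin (b + 1)) :=
  Equiv.ofBijective
    (Fin.cons (Fin.last b) fun i => (σ i).castSucc : Fin (b + 1) → Fin (b + 1))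
    (Finite.injective_iff_bijective.1 (Fin.cons_injective_iff.2
      ⟨fun ⟨i, hi⟩ => (Fin.castSucc_lt_last (σ i)).ne hi,
        fun _ _ h => σ.injective (Fin.castSucc_injective b h)⟩))

@[simp] lemma consMax_zero {b : ℕ} (σ : Equiv.Perm (Fin b)) : consMax σ 0 = Fin.last b := rfl

@[simp] lemma consMax_succ {b : ℕ} (σ : Equiv.Perm (Fin b)) (i : Fin b) :
    consMax σ i.succ = (σ i).castSucc := rfl

lemma consMax_injective {b : ℕ} : Function.Injective (consMax (b := b)) := by
  intro σ τ h
  refine Equiv.ext fun i => ?_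
  simpa using Equiv.congr_fun h i.succ

lemma Avoids231.consMax {b : ℕ} {σ : Equiv.Perm (Fin b)} (hσ : Avoids231 σ) :
    Avoids231 (consMax σ) := by
  rintro ⟨i, j, k, h1, h2, h3, h4⟩
  obtain ⟨j, rfl⟩ := Fin.exists_succ_eq.2 (Fin.ne_zero_of_lt h1)
  obtain ⟨k, rfl⟩ := Fin.exists_succ_eq.2 (Fin.ne_zero_of_lt h2)
  induction i using Fin.cases with
  | zero => exact absurd h4 (not_lt.2 (by simpa using Fin.le_last _))
  | succ i =>
    simp only [consMax_succ, Fin.castSucc_lt_castSucc_iff, Fin.succ_lt_succ_iff] at h1 h2 h3 h4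
    exact hσ ⟨i, j, k, h1, h2, h3, h4⟩

lemma classCard_avoids231_mul_le {n a b : ℕ} (h : a + b = n) :
    classCard (fun _ => Avoids231) a * classCard (fun _ => Avoids231) b ≤
      ((Finset.univ.filter fun σ : Equiv.Perm (Fin (n + 1)) => Avoids231 σ).filter
        fun σ => ((σ.symm (Fin.last n) : Fin (n + 1)) : ℕ) = a).card := by
  subst h
  unfold classCard
  rw [← Finset.card_product]
  refine Finset.card_le_card_of_injOn
    (fun p => (directSum p.1 (consMax p.2) : Equiv.Perm (Fin (a + (b + 1))))) ?_ ?_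
  · rintro ⟨σ, τ⟩ hp
    simp only [Finset.coe_product, Finset.coe_filter, Finset.mem_univ, true_and, Set.mem_prod,
      Set.mem_ofPred_eq] at hp
    simp only [Finset.coe_filter, Finset.mem_filter, Finset.mem_univ, true_and,
      Set.mem_ofPred_eq]
    refine ⟨hp.1.directSum hp.2.consMax, ?_⟩
    have h0 : directSum σ (consMax τ) (Fin.natAdd a 0) = Fin.last (a + b) := by
      rw [directSum_natAdd, consMax_zero]; rfl
    have h1 : (directSum σ (consMax τ)).symm (Fin.last (a + b)) = Fin.natAdd a 0 :=
      (Equiv.symm_apply_eq _).2 h0.symm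
    exact (congrArg Fin.val h1).trans (by simp)
  · rintro ⟨σ, τ⟩ - ⟨σ', τ'⟩ - h
    have := directSum_injective (a₁ := (σ, consMax τ)) (a₂ := (σ', consMax τ')) h
    rw [Prod.mk.injEq] at this
    exact Prod.ext this.1 (consMax_injective this.2)

lemma catalan_le_classCard_avoids231 (n : ℕ) :
    catalan n ≤ classCard (fun _ => Avoids231) n := by
  induction n using Nat.strong_induction_on with
  | _ n ih =>
    cases n with
    | zero =>
      rw [catalan_zero]
      refine Finset.card_pos.2 ⟨1, ?_⟩
      simp [Avoids231]
    | succ n =>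
      rw [catalan_succ']
      unfold classCard
      rw [Finset.card_eq_sum_card_fiberwise (t := Finset.range (n + 1))
        (f := fun σ : Equiv.Perm (Fin (n + 1)) => ((σ.symm (Fin.last n) : Fin (n + 1)) : ℕ))
        (fun σ _ => by simpa using Fin.is_le _),
        Finset.Nat.sum_antidiagonal_eq_sum_range_succ_mk]
      refine Finset.sum_le_sum fun i hi => ?_
      have hi' : i < n + 1 := Finset.mem_range.1 hi
      exact (Nat.mul_le_mul (ih i hi') (ih (n - i) (by omega))).trans
        (classCard_avoids231_mul_le (by omega))

/-- The inversion generating function of the class `A` at `exp c`. -/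
def invWeight (A : ∀ n : ℕ, Equiv.Perm (Fin n) → Prop) (c : ℝ) (n : ℕ) : ℝ :=
  ∑ σ ∈ Finset.univ.filter (fun σ : Equiv.Perm (Fin n) => A n σ), Real.exp (c * invCount σ)

lemma invCount_le {n : ℕ} (σ : Equiv.Perm (Fin n)) : invCount σ ≤ n * n := by
  refine (Finset.card_le_univ _).trans_eq ?_
  simp

lemma invCount_one (n : ℕ) : invCount (1 : Equiv.Perm (Fin n)) = 0 := by
  rw [invCount, Finset.card_eq_zero, Finset.filter_eq_empty_iff]
  rintro ⟨x, y⟩ - ⟨h1, h2⟩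
  exact lt_asymm h1 h2

section invWeight

variable {A : ∀ n : ℕ, Equiv.Perm (Fin n) → Prop} {c : ℝ}

lemma invWeight_nonneg (n : ℕ) : 0 ≤ invWeight A c n :=
  Finset.sum_nonneg fun _ _ => (Real.exp_pos _).le

lemma one_le_invWeight (hone : ∀ n, A n 1) (n : ℕ) : 1 ≤ invWeight A c n := by
  have h := Finset.single_le_sum (f := fun σ : Equiv.Perm (Fin n) => Real.exp (c * invCount σ))
    (s := Finset.univ.filter fun σ => A n σ) (fun _ _ => (Real.exp_pos _).le)
    (Finset.mem_filter.2 ⟨Finset.mem_univ 1, hone n⟩)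
  simp only [invCount_one, Nat.cast_zero, mul_zero, Real.exp_zero] at h
  exact h

lemma invWeight_le_classCard (hc : c ≤ 0) (n : ℕ) : invWeight A c n ≤ classCard A n := by
  have h := Finset.sum_le_card_nsmul (Finset.univ.filter fun σ : Equiv.Perm (Fin n) => A n σ)
    (fun σ => Real.exp (c * invCount σ)) 1
    (fun σ _ => Real.exp_le_one_iff.2 (mul_nonpos_of_nonpos_of_nonneg hc (Nat.cast_nonneg _)))
  simpa [invWeight, classCard] using h

lemma classCard_mul_exp_le_invWeight (hc : c ≤ 0) (n : ℕ) :
    classCard A n * Real.exp (c * (n * n)) ≤ invWeight A c n := by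
  have h := Finset.card_nsmul_le_sum (Finset.univ.filter fun σ : Equiv.Perm (Fin n) => A n σ)
    (fun σ => Real.exp (c * invCount σ)) (Real.exp (c * (n * n)))
    (fun σ _ => Real.exp_le_exp.2 (mul_le_mul_of_nonpos_left
      (by exact_mod_cast invCount_le σ) hc))
  simpa [invWeight, classCard] using h

lemma invWeight_mul_le (hc : c ≤ 0)
    (hsum : ∀ {a b : ℕ} {σ : Equiv.Perm (Fin a)} {τ : Equiv.Perm (Fin b)},
      A a σ → A b τ → A (a + b) (directSum σ τ)) (a b : ℕ) :
    invWeight A c a * invWeight A c b ≤ invWeight A c (a + b) := by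
  unfold invWeight
  rw [Finset.sum_mul_sum, ← Finset.sum_product']
  calc _ ≤ ∑ p ∈ (Finset.univ.filter fun σ : Equiv.Perm (Fin a) => A a σ) ×ˢ
            (Finset.univ.filter fun σ : Equiv.Perm (Fin b) => A b σ),
            Real.exp (c * invCount (directSum p.1 p.2)) := by
        refine Finset.sum_le_sum fun p _ => ?_
        rw [← Real.exp_add, ← mul_add]
        exact Real.exp_le_exp.2 (mul_le_mul_of_nonpos_left
          (by exact_mod_cast invCount_directSum_le p.1 p.2) hc)
    _ = ∑ σ ∈ ((Finset.univ.filter fun σ : Equiv.Perm (Fin a) => A a σ) ×ˢ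
            (Finset.univ.filter fun σ : Equiv.Perm (Fin b) => A b σ)).image
            (fun p => directSum p.1 p.2), Real.exp (c * invCount σ) :=
        by rw [Finset.sum_image directSum_injective.injOn]
    _ ≤ _ := by
        refine Finset.sum_le_sum_of_subset_of_nonneg ?_ fun _ _ _ => (Real.exp_pos _).le
        intro σ hσ
        obtain ⟨p, hp, rfl⟩ := Finset.mem_image.1 hσ
        rw [Finset.mem_product, Finset.mem_filter, Finset.mem_filter] at hp
        exact Finset.mem_filter.2 ⟨Finset.mem_univ _, hsum hp.1.2 hp.2.2⟩

lemma invWeight_pow_le (hc : c ≤ 0) (hone : ∀ n, A n 1)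
    (hsum : ∀ {a b : ℕ} {σ : Equiv.Perm (Fin a)} {τ : Equiv.Perm (Fin b)},
      A a σ → A b τ → A (a + b) (directSum σ τ)) (m k r : ℕ) :
    invWeight A c m ^ k ≤ invWeight A c (r + m * k) := by
  induction k with
  | zero => simpa using one_le_invWeight hone r
  | succ k ih =>
    rw [pow_succ, Nat.mul_succ, ← add_assoc]
    exact (mul_le_mul_of_nonneg_right ih (invWeight_nonneg m)).trans
      (invWeight_mul_le hc hsum _ _)

end invWeight

lemma log_catalan_lower_bound {m : ℕ} (hm : 0 < m) :
    m * Real.log 4 - (Real.log 4 + 2 * Real.log m) ≤ Real.log (catalan m) := by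
  have h1 := Nat.four_pow_le_two_mul_self_mul_centralBinom m hm
  rw [← succ_mul_catalan_eq_centralBinom] at h1
  have h2 : 4 ^ m ≤ 4 * m ^ 2 * catalan m := by
    refine h1.trans ?_
    have : m ≤ m ^ 2 := Nat.le_self_pow two_ne_zero m
    calc 2 * m * ((m + 1) * catalan m) = (2 * m ^ 2 + 2 * m) * catalan m := by ring
      _ ≤ 4 * m ^ 2 * catalan m := Nat.mul_le_mul_right _ (by omega)
  have hcat : 0 < catalan m := by
    by_contra hcon
    rw [Nat.eq_zero_of_not_pos hcon, mul_zero] at h2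
    exact absurd h2 (not_le.2 (by positivity))
  have h3 : (4 : ℝ) ^ m ≤ 4 * (m : ℝ) ^ 2 * catalan m := by exact_mod_cast h2
  have hm' : (0 : ℝ) < m := by exact_mod_cast hm
  have hcat' : (0 : ℝ) < catalan m := by exact_mod_cast hcat
  have h4 := Real.log_le_log (by positivity) h3
  rw [Real.log_pow, Real.log_mul (by positivity) hcat'.ne', Real.log_mul (by norm_num)
    (by positivity), Real.log_pow] at h4
  push_cast at h4
  linarith

lemma tendsto_log_catalan_div :
    Tendsto (fun m : ℕ => Real.log 4 - (Real.log 4 + 2 * Real.log m) / m) atTop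
      (nhds (Real.log 4)) := by
  have h1 : Tendsto (fun m : ℕ => Real.log m / m) atTop (nhds 0) :=
    (Real.isLittleO_log_id_atTop.tendsto_div_nhds_zero).comp tendsto_natCast_atTop_atTop
  have h2 := (tendsto_const_div_atTop_nhds_zero_nat (Real.log 4)).add (h1.const_mul 2)
  have h3 := h2.const_sub (Real.log 4)
  simp only [mul_zero, add_zero, sub_zero] at h3
  refine h3.congr fun m => ?_
  ring

lemma tendsto_of_le_of_sub_div_le {u L : ℕ → ℝ} {l : ℝ} (hu : ∀ n, 0 < n → u n ≤ l)
    (hL : Tendsto L atTop (nhds l))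
    (h : ∀ m, 0 < m → ∃ C : ℝ, ∀ n : ℕ, 0 < n → L m - C / n ≤ u n) :
    Tendsto u atTop (nhds l) := by
  refine tendsto_order.2 ⟨fun a ha => ?_, fun a ha => ?_⟩
  · obtain ⟨m, hm, hm0⟩ :=
      (((tendsto_order.1 hL).1 a ha).and (eventually_gt_atTop 0)).exists
    obtain ⟨C, hC⟩ := h m hm0
    have ht : Tendsto (fun n : ℕ => L m - C / n) atTop (nhds (L m)) := by
      simpa using (tendsto_const_div_atTop_nhds_zero_nat C).const_sub (L m)
    filter_upwards [(tendsto_order.1 ht).1 a hm, eventually_gt_atTop 0] with n hn hn0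
    exact hn.trans_le (hC n hn0)
  · filter_upwards [eventually_gt_atTop 0] with n hn0
    exact (hu n hn0).trans_lt ha

/-- A class of permutations closed under direct sums with between `catalan n` and `4 ^ n` members
of each size has `log 4` as the exponential growth rate of its Mallows partition function. -/
lemma tendsto_log_invWeight_div {A : ∀ n : ℕ, Equiv.Perm (Fin n) → Prop} {β : ℝ} (hβ : β ≤ 0)
    (hone : ∀ n, A n 1)
    (hsum : ∀ {a b : ℕ} {σ : Equiv.Perm (Fin a)} {τ : Equiv.Perm (Fin b)},
      A a σ → A b τ → A (a + b) (directSum σ τ))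
    (hupper : ∀ n, classCard A n ≤ 4 ^ n) (hlower : ∀ n, catalan n ≤ classCard A n) :
    Tendsto (fun n : ℕ => Real.log (invWeight A (β / n) n) / n) atTop (nhds (Real.log 4)) := by
  have hc : ∀ n : ℕ, β / n ≤ 0 := fun n => div_nonpos_of_nonpos_of_nonneg hβ (Nat.cast_nonneg n)
  have hcard : ∀ n, 1 ≤ classCard A n := fun n =>
    Finset.card_pos.2 ⟨1, Finset.mem_filter.2 ⟨Finset.mem_univ _, hone n⟩⟩
  refine tendsto_of_le_of_sub_div_le (fun n hn => ?_) tendsto_log_catalan_div fun m hm => ?_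
  · have hn' : (0 : ℝ) < n := by exact_mod_cast hn
    rw [div_le_iff₀ hn', mul_comm, ← Real.log_pow]
    refine Real.log_le_log (zero_lt_one.trans_le (one_le_invWeight hone n))
      ((invWeight_le_classCard (hc n) n).trans ?_)
    exact_mod_cast hupper n
  · refine ⟨Real.log (classCard A m) - β * m, fun n hn => ?_⟩
    have hn' : (0 : ℝ) < n := by exact_mod_cast hn
    have hm' : (0 : ℝ) < m := by exact_mod_cast hm
    have hcm : (1 : ℝ) ≤ classCard A m := by exact_mod_cast hcard m
    have hlog : 0 ≤ Real.log (classCard A m) := Real.log_nonneg hcm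
    have hcat : (0 : ℝ) < catalan m := by
      have : 0 < catalan m := by
        have h1 := succ_mul_catalan_eq_centralBinom m
        have h2 := Nat.centralBinom_pos m
        exact Nat.pos_of_mul_pos_left (h1 ▸ h2)
      exact_mod_cast this
    have hL : m * (Real.log 4 - (Real.log 4 + 2 * Real.log m) / m) ≤
        Real.log (classCard A m) := by
      rw [mul_sub, mul_div_cancel₀ _ hm'.ne']
      exact (log_catalan_lower_bound hm).trans
        (Real.log_le_log hcat (by exact_mod_cast hlower m))
    set L := Real.log 4 - (Real.log 4 + 2 * Real.log m) / m
    have hW : (n / m : ℕ) * (Real.log (classCard A m) + β / n * (m * m)) ≤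
        Real.log (invWeight A (β / n) n) := by
      have h1 := (pow_le_pow_left₀ (by positivity)
        (classCard_mul_exp_le_invWeight (A := A) (hc n) m) (n / m)).trans
        (invWeight_pow_le (hc n) hone hsum m (n / m) (n % m))
      rw [Nat.mod_add_div] at h1
      have h2 := Real.log_le_log (by positivity) h1
      rwa [Real.log_pow, Real.log_mul (by positivity) (Real.exp_pos _).ne', Real.log_exp] at h2
    have hk1 : ((n / m : ℕ) : ℝ) * m ≤ n := by exact_mod_cast Nat.div_mul_le_self n m
    have hk2 : (n : ℝ) / m ≤ ((n / m : ℕ) : ℝ) + 1 := by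
      rw [div_le_iff₀ hm']
      have h := Nat.lt_mul_div_succ n hm
      rw [mul_comm] at h
      exact_mod_cast h.le
    have hexp : β * m ≤ (n / m : ℕ) * (β / n * (m * m)) := by
      have h1 : ((n / m : ℕ) : ℝ) * (β / n * (m * m)) =
          β * m * (((n / m : ℕ) : ℝ) * m / n) := by ring
      rw [h1]
      have h2 : ((n / m : ℕ) : ℝ) * m / n ≤ 1 := (div_le_one hn').2 hk1
      nlinarith [mul_nonneg (neg_nonneg.2 hβ) hm'.le]
    have hmain : n * L ≤ (((n / m : ℕ) : ℝ) + 1) * Real.log (classCard A m) := by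
      calc n * L = n / m * (m * L) := by field_simp
        _ ≤ n / m * Real.log (classCard A m) := mul_le_mul_of_nonneg_left hL (by positivity)
        _ ≤ _ := mul_le_mul_of_nonneg_right hk2 hlog
    rw [sub_le_iff_le_add, ← add_div, le_div_iff₀ hn']
    linarith

/-- Asymptotics of the partition functions for `β ≤ 0`: both grow like `4^n`. -/
theorem partition_asymptotics_nonpositive_beta (β : ℝ) (hβ : β ≤ 0) :
    Filter.Tendsto (fun n : ℕ => Real.log (Z231 β n) / n) Filter.atTop
      (nhds (Real.log 4)) ∧
    Filter.Tendsto (fun n : ℕ => Real.log (Z321 β n) / n) Filter.atTop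
      (nhds (Real.log 4)) := by
  have h231 : ∀ n, Avoids231 (1 : Equiv.Perm (Fin n)) := by
    rintro n ⟨i, j, k, h1, h2, h3, -⟩
    exact lt_asymm (h1.trans h2) h3
  have h321 : ∀ n, Avoids321 (1 : Equiv.Perm (Fin n)) := by
    rintro n ⟨i, j, k, h1, -, h3, -⟩
    exact lt_asymm h1 h3
  exact ⟨tendsto_log_invWeight_div (A := fun _ => Avoids231) hβ h231
      (fun hσ hτ => hσ.directSum hτ)
      (fun n => classCard_le_four_pow (rlMinData_injOn_avoids231 n))
      catalan_le_classCard_avoids231,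
    tendsto_log_invWeight_div (A := fun _ => Avoids321) hβ h321
      (fun hσ hτ => hσ.directSum hτ)
      (fun n => classCard_le_four_pow (rlMinData_injOn_avoids321 n))
      (fun n => (catalan_le_classCard_avoids231 n).trans (classCard_avoids231_le_avoids321 n))⟩

end
end

section
/- Let f be a nondecreasing càdlàg function from [0,1] to [0,1] with f(x) ≤ x for all x and f(1) = 1. Let H_f = {(x,y) ∈ [0,1]²: y ≥ f(x)}, let G_f = {(x,y): f(x⁻) ≤ y ≤ f(x)} be the completed graph of f, and for (x,y) ∈ [0,1]² let G_f(x,y) = G_f ∩ ([x,1] × [0,y]). Define P_f(x,y) := y − x + min_{(x',y') ∈ G_f(x,y)} (x' − y') if (x,y) ∈ H_f, and P_f(x,y) := 0 if y < f(x). Then there exists exactly one 231-avoiding permuton μ such that μ([x,1] × [0,y]) = P_f(x,y) for all (x,y) ∈ [0,1]²; moreover this μ is the unique 231-avoiding permuton whose RLM curve f_μ equals f. -/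
open MeasureTheory Filter Set

noncomputable section

/-- A permuton: a Borel probability measure on the plane (supported on `[0,1]²`) whose
two marginals are the Lebesgue measure on `[0,1]`. -/
def IsPermuton (μ : Measure (ℝ × ℝ)) : Prop :=
  IsProbabilityMeasure μ ∧
    μ.map Prod.fst = volume.restrict (Set.Icc (0:ℝ) 1) ∧
    μ.map Prod.snd = volume.restrict (Set.Icc (0:ℝ) 1)

/-- A permuton avoids the pattern `231` if `μ⊗μ⊗μ` gives zero mass to triples of
points in relative position `231`. -/
def PermutonAvoids231 (μ : Measure (ℝ × ℝ)) : Prop :=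
  (μ.prod (μ.prod μ))
    {t : (ℝ × ℝ) × (ℝ × ℝ) × (ℝ × ℝ) |
      t.1.1 < t.2.1.1 ∧ t.2.1.1 < t.2.2.1 ∧ t.2.2.2 < t.1.2 ∧ t.1.2 < t.2.1.2} = 0

/-- The RLM curve of a permuton: `f_μ(x) = max{y ∈ [0,1] : μ([x,1]×[0,y]) = 0}`. -/
def RLMcurve (μ : Measure (ℝ × ℝ)) (x : ℝ) : ℝ :=
  sSup {y : ℝ | y ∈ Set.Icc (0:ℝ) 1 ∧ μ (Set.Icc x 1 ×ˢ Set.Icc 0 y) = 0}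

/-- The completed graph `G_f = {(x,y) : x ∈ [0,1], f(x⁻) ≤ y ≤ f(x)}` of `f`. -/
def completedGraph (f : ℝ → ℝ) : Set (ℝ × ℝ) :=
  {p : ℝ × ℝ | p.1 ∈ Set.Icc (0:ℝ) 1 ∧ p.2 ∈ Set.Icc (Function.leftLim f p.1) (f p.1)}

/-- The part `G_f(x,y) = G_f ∩ ([x,1] × [0,y])` of the completed graph. -/
def graphPart (f : ℝ → ℝ) (x y : ℝ) : Set (ℝ × ℝ) :=
  completedGraph f ∩ Set.Icc x 1 ×ˢ Set.Icc 0 y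

/-- `P_f(x,y) = y − x + min{x' − y' : (x',y') ∈ G_f(x,y)}` if `y ≥ f(x)`, `0` otherwise. -/
def Pfun (f : ℝ → ℝ) (x y : ℝ) : ℝ :=
  if f x ≤ y then
    y - x + sInf ((fun p : ℝ × ℝ => p.1 - p.2) '' graphPart f x y)
  else 0

theorem sum_range_ite_le_sub (u : ℕ → ℝ) (k n : ℕ) :
    ∑ i ∈ Finset.range n, (if k ≤ i then u i - u (i + 1) else 0) =
      if k ≤ n then u k - u n else 0 := by
  induction n with
  | zero =>
    by_cases h : k = 0 <;> simp [h]
  | succ n ih =>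
    rw [Finset.sum_range_succ, ih]
    rcases lt_trichotomy k (n + 1) with h | h | h
    · rw [if_pos (by omega), if_pos (by omega), if_pos (by omega)]; ring
    · subst h; simp
    · rw [if_neg (by omega), if_neg (by omega), if_neg (by omega)]; ring

theorem sum_range_ite_lt_sub (v : ℕ → ℝ) (l n : ℕ) :
    ∑ j ∈ Finset.range n, (if j < l then v (j + 1) - v j else 0) = v (min l n) - v 0 := by
  induction n with
  | zero => simp
  | succ n ih =>
    rw [Finset.sum_range_succ, ih]
    rcases lt_or_ge n l with h | h
    · rw [if_pos h, min_eq_right h.le, min_eq_right (by omega)]; ring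
    · rw [if_neg (by omega), min_eq_left h, min_eq_left (by omega)]; ring

/-- The mass a two-dimensional distribution function `C` (of the quadrants `[x,∞) × (-∞,y]`)
assigns to the grid cell with lower left corner `(i/n, j/n)`. -/
def cellMass (C : ℝ → ℝ → ℝ) (n i j : ℕ) : ℝ :=
  (C (i / n) ((j + 1 : ℕ) / n) - C (i / n) (j / n)) -
    (C ((i + 1 : ℕ) / n) ((j + 1 : ℕ) / n) - C ((i + 1 : ℕ) / n) (j / n))

/-- The discretisation of `C`: the mass of each cell is put on its lower left corner. -/
def gridMeasure (C : ℝ → ℝ → ℝ) (n : ℕ) : Measure (ℝ × ℝ) :=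
  ∑ i ∈ Finset.range n, ∑ j ∈ Finset.range n,
    ENNReal.ofReal (cellMass C n i j) • Measure.dirac ((i / n : ℝ), (j / n : ℝ))

theorem cellMass_nonneg {C : ℝ → ℝ → ℝ}
    (hC : ∀ x x' y y', x ≤ x' → y ≤ y' → C x y + C x' y' ≤ C x y' + C x' y) (n i j : ℕ) :
    0 ≤ cellMass C n i j := by
  have := hC (i / n) ((i + 1 : ℕ) / n) (j / n) ((j + 1 : ℕ) / n)
    (by gcongr; omega) (by gcongr; omega)
  unfold cellMass
  linarith

theorem gridMeasure_quadrant {C : ℝ → ℝ → ℝ}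
    (hC : ∀ x x' y y', x ≤ x' → y ≤ y' → C x y + C x' y' ≤ C x y' + C x' y)
    (hx1 : ∀ x y, 1 ≤ x → C x y = 0) (hy0 : ∀ x y, y ≤ 0 → C x y = 0)
    (hy1 : ∀ x y, 1 ≤ y → C x y = C x 1) {n : ℕ} (hn : 0 < n) (x y : ℝ) :
    gridMeasure C n (Ici x ×ˢ Iio y) =
      ENNReal.ofReal (C ((⌈n * x⌉₊ : ℕ) / n) ((⌈n * y⌉₊ : ℕ) / n)) := by
  have hn' : (0 : ℝ) < n := by exact_mod_cast hn
  have hge : ∀ m : ℕ, n ≤ m → (1 : ℝ) ≤ m / n := fun m hm => by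
    rw [le_div_iff₀ hn', one_mul]; exact_mod_cast hm
  have hmem : ∀ i j : ℕ, ((i / n : ℝ), (j / n : ℝ)) ∈ Ici x ×ˢ Iio y ↔
      ⌈n * x⌉₊ ≤ i ∧ j < ⌈n * y⌉₊ := fun i j => by
    rw [mem_prod, mem_Ici, mem_Iio, Nat.ceil_le, Nat.lt_ceil, le_div_iff₀ hn', div_lt_iff₀ hn',
      mul_comm x, mul_comm y]
  have key : gridMeasure C n (Ici x ×ˢ Iio y) = ENNReal.ofReal
      (∑ i ∈ Finset.range n, ∑ j ∈ Finset.range n,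
        if ⌈n * x⌉₊ ≤ i then (if j < ⌈n * y⌉₊ then cellMass C n i j else 0) else 0) := by
    have h0 := cellMass_nonneg hC n
    rw [ENNReal.ofReal_sum_of_nonneg
      (fun i _ => Finset.sum_nonneg fun j _ => by split_ifs <;> simp [h0])]
    simp only [gridMeasure, Measure.coe_finsetSum, Finset.sum_apply, Measure.smul_apply]
    refine Finset.sum_congr rfl fun i _ => ?_
    rw [ENNReal.ofReal_sum_of_nonneg (fun j _ => by split_ifs <;> simp [h0])]
    refine Finset.sum_congr rfl fun j _ => ?_
    rw [Measure.dirac_apply' _ (measurableSet_Ici.prod measurableSet_Iio)]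
    by_cases h : ⌈n * x⌉₊ ≤ i ∧ j < ⌈n * y⌉₊
    · rw [indicator_of_mem ((hmem i j).2 h), if_pos h.1, if_pos h.2]
      simp
    · rw [indicator_of_notMem (fun h' => h ((hmem i j).1 h'))]
      rw [not_and] at h
      split_ifs with h1 h2
      · exact absurd h2 (h h1)
      · simp
      · simp
  rw [key]
  congr 1
  generalize ⌈n * x⌉₊ = k
  generalize ⌈n * y⌉₊ = l
  have hinner : ∀ i : ℕ, (∑ j ∈ Finset.range n,
      if k ≤ i then (if j < l then cellMass C n i j else 0) else 0) =
      if k ≤ i then C (i / n) (l / n) - C ((i + 1 : ℕ) / n) (l / n) else 0 := fun i => by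
    split_ifs with h
    · have := sum_range_ite_lt_sub
        (fun j => C (i / n) (j / n) - C ((i + 1 : ℕ) / n) (j / n)) l n
      have hmin : ∀ t, C t ((min l n : ℕ) / n) = C t (l / n) := fun t => by
        rcases le_total l n with h | h
        · rw [min_eq_left h]
        · rw [min_eq_right h, hy1 _ _ (hge _ le_rfl), hy1 _ _ (hge _ h)]
      simp only [hmin] at this
      rw [show ((0 : ℕ) : ℝ) / n = 0 by simp, hy0 _ _ le_rfl, hy0 _ _ le_rfl] at this
      rw [sub_zero, sub_zero] at this
      rw [← this]
      refine Finset.sum_congr rfl fun j _ => ?_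
      split_ifs
      · unfold cellMass; ring
      · rfl
    · simp
  simp only [hinner]
  rw [sum_range_ite_le_sub (fun i => C (i / n) (l / n)) k n]
  split_ifs with h
  · rw [hx1 (n / n) _ (hge _ le_rfl), sub_zero]
  · rw [hx1 _ _ (hge _ (by omega))]

theorem gridMeasure_compl_Ico (C : ℝ → ℝ → ℝ) (n : ℕ) :
    gridMeasure C n (Ico (0 : ℝ) 1 ×ˢ Ico (0 : ℝ) 1)ᶜ = 0 := by
  have hI : ∀ i ∈ Finset.range n, (i / n : ℝ) ∈ Ico (0 : ℝ) 1 := fun i hi => by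
    have h : i < n := Finset.mem_range.1 hi
    have h' : (0 : ℝ) < n := by exact_mod_cast (by omega : 0 < n)
    refine ⟨by positivity, ?_⟩
    rw [div_lt_one h']
    exact_mod_cast h
  simp only [gridMeasure, Measure.coe_finsetSum, Finset.sum_apply, Measure.smul_apply]
  refine Finset.sum_eq_zero fun i hi => Finset.sum_eq_zero fun j hj => ?_
  rw [Measure.dirac_apply' _ (measurableSet_Ico.prod measurableSet_Ico).compl,
    indicator_of_notMem (fun h => (h : ¬ _) (mk_mem_prod (hI i hi) (hI j hj))), smul_zero]

/-- A function that is Lipschitz, two-increasing and has the right boundary values is the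
distribution function of a probability measure on the plane. -/
theorem exists_measure_quadrant_eq {C : ℝ → ℝ → ℝ}
    (hC : ∀ x x' y y', x ≤ x' → y ≤ y' → C x y + C x' y' ≤ C x y' + C x' y)
    (hlip : ∀ x x' y y', |C x y - C x' y'| ≤ |x - x'| + |y - y'|)
    (hx1 : ∀ x y, 1 ≤ x → C x y = 0) (hy0 : ∀ x y, y ≤ 0 → C x y = 0)
    (hx0 : ∀ x y, x ≤ 0 → C x y = C 0 y)
    (hy1 : ∀ x y, 1 ≤ y → C x y = C x 1) (h01 : C 0 1 = 1) :
    ∃ μ : Measure (ℝ × ℝ), IsProbabilityMeasure μ ∧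
      ∀ x y, μ (Ici x ×ˢ Iic y) = ENNReal.ofReal (C x y) := by
  have hcont : Continuous fun p : ℝ × ℝ => C p.1 p.2 := by
    rw [Metric.continuous_iff]
    intro p ε hε
    refine ⟨ε / 2, by positivity, fun q hq => ?_⟩
    rw [Prod.dist_eq, max_lt_iff, Real.dist_eq, Real.dist_eq] at hq
    rw [Real.dist_eq]
    linarith [hlip q.1 p.1 q.2 p.2]
  have hprob : ∀ n : ℕ, IsProbabilityMeasure (gridMeasure C (n + 1)) := fun n => ⟨by
    have hle : gridMeasure C (n + 1) (Ici (0 : ℝ) ×ˢ Iio (1 : ℝ))ᶜ = 0 :=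
      measure_mono_null (compl_subset_compl.2
        (Set.prod_mono (fun t ht => ht.1) (fun t ht => ht.2))) (gridMeasure_compl_Ico C (n + 1))
    rw [← measure_add_measure_compl (measurableSet_Ici.prod measurableSet_Iio), hle, add_zero,
      gridMeasure_quadrant hC hx1 hy0 hy1 n.succ_pos]
    have h2 : ((⌈((n + 1 : ℕ) : ℝ) * 1⌉₊ : ℕ) : ℝ) / (n + 1 : ℕ) = 1 := by
      rw [mul_one, Nat.ceil_natCast, div_self (by positivity)]
    rw [h2]
    simp [h01]⟩
  let P : ℕ → ProbabilityMeasure (ℝ × ℝ) := fun n => ⟨gridMeasure C (n + 1), hprob n⟩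
  have htight : IsTightMeasureSet {((ρ : ProbabilityMeasure (ℝ × ℝ)) : Measure (ℝ × ℝ)) |
      ρ ∈ range P} := by
    rw [isTightMeasureSet_iff_exists_isCompact_measure_compl_le]
    refine fun ε _ => ⟨Icc (0 : ℝ) 1 ×ˢ Icc (0 : ℝ) 1, isCompact_Icc.prod isCompact_Icc, ?_⟩
    rintro _ ⟨_, ⟨n, rfl⟩, rfl⟩
    refine (measure_mono_null (compl_subset_compl.2 (Set.prod_mono Ico_subset_Icc_self
      Ico_subset_Icc_self)) (gridMeasure_compl_Ico C (n + 1))).le.trans zero_le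
  obtain ⟨ρ, -, hρ⟩ := (isCompact_closure_of_isTightMeasureSet htight).ultrafilter_le_nhds
    ((hyperfilter ℕ).map P) (by
      rw [le_principal_iff]
      exact Filter.mem_of_superset (Filter.mem_map.2 (Filter.univ_mem' fun n => mem_range_self n))
        subset_closure)
  have hρ' : Tendsto P (hyperfilter ℕ : Filter ℕ) (nhds ρ) := hρ
  have hlim : ∀ x y, Tendsto (fun n => (P n : Measure (ℝ × ℝ)) (Ici x ×ˢ Iio y))
      (hyperfilter ℕ : Filter ℕ) (nhds (ENNReal.ofReal (C x y))) := by
    intro x y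
    have hceil : ∀ t : ℝ, Tendsto (fun n : ℕ => ((⌈((n + 1 : ℕ) : ℝ) * t⌉₊ : ℕ) : ℝ) /
        ((n + 1 : ℕ) : ℝ)) atTop (nhds (max t 0)) := by
      intro t
      rcases le_total t 0 with h | h
      · rw [max_eq_right h]
        refine tendsto_const_nhds.congr fun n => ?_
        rw [Nat.ceil_eq_zero.2 (mul_nonpos_of_nonneg_of_nonpos (by positivity) h)]
        simp
      · rw [max_eq_left h]
        have := (tendsto_nat_ceil_mul_div_atTop h).comp
          (tendsto_natCast_atTop_atTop.comp (tendsto_add_atTop_nat 1))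
        refine this.congr fun n => ?_
        simp [mul_comm]
    have hmax : C x y = C (max x 0) (max y 0) := by
      rcases le_total y 0 with h | h
      · rw [max_eq_right h, hy0 _ _ h, hy0 _ _ le_rfl]
      · rw [max_eq_left h]
        rcases le_total x 0 with h' | h'
        · rw [max_eq_right h', hx0 _ _ h']
        · rw [max_eq_left h']
    rw [hmax]
    refine (((ENNReal.continuous_ofReal.comp hcont).tendsto (max x 0, max y 0)).comp
      (((hceil x).prodMk_nhds (hceil y)).mono_left Nat.hyperfilter_le_atTop)).congr fun n => ?_
    exact (gridMeasure_quadrant hC hx1 hy0 hy1 n.succ_pos x y).symm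
  refine ⟨ρ, inferInstance, fun x y => le_antisymm ?_ ?_⟩
  · have hopen : ∀ x y, (ρ : Measure (ℝ × ℝ)) (Ioi x ×ˢ Iio y) ≤ ENNReal.ofReal (C x y) := by
      intro x y
      refine (ProbabilityMeasure.le_liminf_measure_open_of_tendsto hρ'
        (isOpen_Ioi.prod isOpen_Iio)).trans ?_
      rw [← (hlim x y).liminf_eq]
      exact liminf_le_liminf (Filter.Eventually.of_forall fun n =>
        measure_mono (Set.prod_mono Ioi_subset_Ici_self subset_rfl))
    refine ge_of_tendsto (f := fun ε : ℝ => ENNReal.ofReal (C (x - ε) (y + ε)))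
      (x := nhdsWithin 0 (Ioi 0)) ?_ ?_
    · have : Continuous fun ε : ℝ => ENNReal.ofReal (C (x - ε) (y + ε)) :=
        ENNReal.continuous_ofReal.comp (hcont.comp (by fun_prop : Continuous fun ε : ℝ =>
          (x - ε, y + ε)))
      have h := this.tendsto 0
      simp only [sub_zero, add_zero] at h
      exact h.mono_left nhdsWithin_le_nhds
    · filter_upwards [self_mem_nhdsWithin] with ε hε
      have hε' : (0 : ℝ) < ε := hε
      refine (measure_mono (Set.prod_mono (fun t ht => ?_) (fun t ht => ?_))).trans (hopen _ _)
      · rw [mem_Ici] at ht; rw [mem_Ioi]; linarith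
      · rw [mem_Iic] at ht; rw [mem_Iio]; linarith
  · refine le_trans ?_ (ProbabilityMeasure.limsup_measure_closed_le_of_tendsto hρ'
      (isClosed_Ici.prod isClosed_Iic))
    rw [← (hlim x y).limsup_eq]
    exact limsup_le_limsup (Filter.Eventually.of_forall fun n =>
      measure_mono (Set.prod_mono subset_rfl Iio_subset_Iic_self))

theorem max_sub_zero_rearrange {s t u v : ℝ} (hst : s ≤ t) (huv : u ≤ v) :
    max (s - u) 0 + max (t - v) 0 ≤ max (t - u) 0 + max (s - v) 0 := by
  rcases max_cases (s - u) 0 with h1 | h1 <;> rcases max_cases (t - v) 0 with h2 | h2 <;>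
    rcases max_cases (t - u) 0 with h3 | h3 <;> rcases max_cases (s - v) 0 with h4 | h4 <;>
    linarith

/-- The total mass of the vertical strip between `x` and `p.1` and the horizontal strip between
`p.2` and `y`: if a permuton gives no mass to the quadrant `[p.1,∞) × (-∞,p.2]`, this bounds the
mass of the quadrant `[x,∞) × (-∞,y]`. -/
def stripBound (p : ℝ × ℝ) (x y : ℝ) : ℝ := max (p.1 - x) 0 + max (y - p.2) 0

theorem stripBound_nonneg (p : ℝ × ℝ) (x y : ℝ) : 0 ≤ stripBound p x y :=
  add_nonneg (le_max_right _ _) (le_max_right _ _)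

theorem stripBound_swap {p q : ℝ × ℝ} {x x' y y' : ℝ} (hx : x ≤ x') (hy : y ≤ y')
    (h : p ≤ q ∨ q ≤ p) :
    stripBound p x y + stripBound q x' y' ≤ stripBound p x y' + stripBound q x' y ∨
      stripBound q x y + stripBound p x' y' ≤ stripBound p x y' + stripBound q x' y := by
  unfold stripBound
  rcases h with h | h
  · left; linarith [max_sub_zero_rearrange hy h.2]
  · right; linarith [max_sub_zero_rearrange h.1 hx]

/-- The best of the bounds `stripBound p x y` for `p ∈ G`. -/
def infStripBound (G : Set (ℝ × ℝ)) (x y : ℝ) : ℝ := ⨅ p : G, stripBound p x y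

section infStripBound

variable {G : Set (ℝ × ℝ)}

theorem infStripBound_le {p : ℝ × ℝ} (hp : p ∈ G) (x y : ℝ) :
    infStripBound G x y ≤ stripBound p x y :=
  ciInf_le (f := fun p : G => stripBound p x y)
    ⟨0, by rintro _ ⟨q, rfl⟩; exact stripBound_nonneg _ _ _⟩ ⟨p, hp⟩

theorem le_infStripBound (hG : G.Nonempty) {x y a : ℝ} (h : ∀ p ∈ G, a ≤ stripBound p x y) :
    a ≤ infStripBound G x y :=
  have := hG.to_subtype
  le_ciInf fun p => h p p.2

theorem infStripBound_nonneg (hG : G.Nonempty) (x y : ℝ) : 0 ≤ infStripBound G x y :=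
  le_infStripBound hG fun p _ => stripBound_nonneg p x y

theorem exists_stripBound_lt (hG : G.Nonempty) (x y : ℝ) {ε : ℝ} (hε : 0 < ε) :
    ∃ p ∈ G, stripBound p x y < infStripBound G x y + ε := by
  have := hG.to_subtype
  obtain ⟨p, hp⟩ := exists_lt_of_ciInf_lt (f := fun p : G => stripBound p x y)
    (lt_add_of_pos_right _ hε)
  exact ⟨p, p.2, hp⟩

theorem infStripBound_two_increasing (hG : G.Nonempty) (hchain : ∀ p ∈ G, ∀ q ∈ G, p ≤ q ∨ q ≤ p)
    {x x' y y' : ℝ} (hx : x ≤ x') (hy : y ≤ y') :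
    infStripBound G x y + infStripBound G x' y' ≤
      infStripBound G x y' + infStripBound G x' y := by
  refine le_of_forall_pos_le_add fun ε hε => ?_
  obtain ⟨p, hp, hp'⟩ := exists_stripBound_lt hG x y' (half_pos hε)
  obtain ⟨q, hq, hq'⟩ := exists_stripBound_lt hG x' y (half_pos hε)
  rcases stripBound_swap hx hy (hchain p hp q hq) with h | h
  · linarith [infStripBound_le hp x y, infStripBound_le hq x' y']
  · linarith [infStripBound_le hq x y, infStripBound_le hp x' y']

theorem infStripBound_le_add (hG : G.Nonempty) (x x' y y' : ℝ) :
    infStripBound G x y ≤ infStripBound G x' y' + |x - x'| + |y - y'| := by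
  suffices infStripBound G x y - |x - x'| - |y - y'| ≤ infStripBound G x' y' by linarith
  refine le_infStripBound hG fun p hp => ?_
  have h1 : max (p.1 - x) 0 ≤ max (p.1 - x') 0 + |x - x'| :=
    max_le (by linarith [le_max_left (p.1 - x') 0, neg_abs_le (x - x')]) (by positivity)
  have h2 : max (y - p.2) 0 ≤ max (y' - p.2) 0 + |y - y'| :=
    max_le (by linarith [le_max_left (y' - p.2) 0, le_abs_self (y - y')]) (by positivity)
  have h3 := infStripBound_le hp x y
  unfold stripBound at h3 ⊢
  linarith

theorem abs_infStripBound_sub_le (hG : G.Nonempty) (x x' y y' : ℝ) :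
    |infStripBound G x y - infStripBound G x' y'| ≤ |x - x'| + |y - y'| := by
  have h1 := infStripBound_le_add hG x x' y y'
  have h2 := infStripBound_le_add hG x' x y' y
  rw [abs_sub_comm x' x, abs_sub_comm y' y] at h2
  rw [abs_le]
  constructor <;> linarith

theorem min_le_infStripBound (hG : G.Nonempty) {p q v w : ℝ} (hpq : p ≤ q) (hvw : v ≤ w)
    (hpos : 0 < infStripBound G q v) :
    min (infStripBound G p v + (w - v)) (infStripBound G q w + (q - p)) ≤
      infStripBound G p w := by
  refine le_infStripBound hG fun r hr => ?_
  rcases le_or_gt q r.1 with h1 | h1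
  · refine (min_le_right _ _).trans ?_
    have := infStripBound_le hr q w
    unfold stripBound at this ⊢
    rw [max_eq_left (by linarith : 0 ≤ r.1 - q)] at this
    rw [max_eq_left (by linarith : 0 ≤ r.1 - p)]
    linarith
  rcases le_or_gt r.2 v with h2 | h2
  · refine (min_le_left _ _).trans ?_
    have := infStripBound_le hr p v
    unfold stripBound at this ⊢
    rw [max_eq_left (by linarith : 0 ≤ v - r.2)] at this
    rw [max_eq_left (by linarith : 0 ≤ w - r.2)]
    linarith
  · have := infStripBound_le hr q v
    unfold stripBound at this
    rw [max_eq_right (by linarith), max_eq_right (by linarith)] at this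
    linarith

end infStripBound

namespace IsPermuton

variable {μ ν : Measure (ℝ × ℝ)}

theorem measure_fst_preimage (hμ : IsPermuton μ) {S : Set ℝ} (hS : MeasurableSet S) :
    μ (Prod.fst ⁻¹' S) = volume (S ∩ Icc 0 1) := by
  rw [← Measure.map_apply measurable_fst hS, hμ.2.1, Measure.restrict_apply hS]

theorem measure_snd_preimage (hμ : IsPermuton μ) {S : Set ℝ} (hS : MeasurableSet S) :
    μ (Prod.snd ⁻¹' S) = volume (S ∩ Icc 0 1) := by
  rw [← Measure.map_apply measurable_snd hS, hμ.2.2, Measure.restrict_apply hS]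

theorem ae_mem_Ioo (hμ : IsPermuton μ) :
    ∀ᵐ p ∂μ, p.1 ∈ Ioo (0 : ℝ) 1 ∧ p.2 ∈ Ioo (0 : ℝ) 1 := by
  have hvol : volume ((Ioo (0 : ℝ) 1)ᶜ ∩ Icc 0 1) = 0 := by
    rw [inter_comm, ← sdiff_eq, Icc_sdiff_Ioo_same zero_le_one]
    exact (toFinite _).measure_zero _
  have h1 : ∀ᵐ p ∂μ, p.1 ∈ Ioo (0 : ℝ) 1 := by
    rw [ae_iff]
    exact (hμ.measure_fst_preimage measurableSet_Ioo.compl).trans hvol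
  have h2 : ∀ᵐ p ∂μ, p.2 ∈ Ioo (0 : ℝ) 1 := by
    rw [ae_iff]
    exact (hμ.measure_snd_preimage measurableSet_Ioo.compl).trans hvol
  exact h1.and h2

theorem measure_quadrant_clamp (hμ : IsPermuton μ) (x y : ℝ) :
    μ (Ici x ×ˢ Iic y) = μ (Ici (max 0 (min x 1)) ×ˢ Iic (max 0 (min y 1))) := by
  refine measure_congr ?_
  filter_upwards [hμ.ae_mem_Ioo] with p hp
  obtain ⟨⟨h1, h2⟩, h3, h4⟩ := hp
  refine propext ?_
  change (x ≤ p.1 ∧ p.2 ≤ y) ↔ (max 0 (min x 1) ≤ p.1 ∧ p.2 ≤ max 0 (min y 1))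
  simp only [max_le_iff, min_le_iff, le_max_iff, le_min_iff]
  grind

theorem measure_Icc_prod_Icc (hμ : IsPermuton μ) (x y : ℝ) :
    μ (Icc x 1 ×ˢ Icc 0 y) = μ (Ici x ×ˢ Iic y) := by
  refine measure_congr ?_
  filter_upwards [hμ.ae_mem_Ioo] with p hp
  obtain ⟨⟨h1, h2⟩, h3, h4⟩ := hp
  refine propext ?_
  change ((x ≤ p.1 ∧ p.1 ≤ 1) ∧ 0 ≤ p.2 ∧ p.2 ≤ y) ↔ (x ≤ p.1 ∧ p.2 ≤ y)
  grind

theorem ext_quadrant (hμ : IsPermuton μ) (hν : IsPermuton ν)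
    (h : ∀ x ∈ Icc (0 : ℝ) 1, ∀ y ∈ Icc (0 : ℝ) 1, μ (Ici x ×ˢ Iic y) = ν (Ici x ×ˢ Iic y)) :
    μ = ν := by
  have := hμ.1
  have := hν.1
  have hclamp : ∀ t : ℝ, max 0 (min t 1) ∈ Icc (0 : ℝ) 1 := fun t =>
    ⟨le_max_left _ _, max_le zero_le_one (min_le_right _ _)⟩
  have h' : ∀ x y : ℝ, μ (Ici x ×ˢ Iic y) = ν (Ici x ×ˢ Iic y) := fun x y => by
    rw [hμ.measure_quadrant_clamp, hν.measure_quadrant_clamp]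
    exact h _ (hclamp x) _ (hclamp y)
  have key : ∀ (x : ℝ) (T : Set ℝ), MeasurableSet T → μ (Ici x ×ˢ T) = ν (Ici x ×ˢ T) := by
    intro x T hT
    have hm : ∀ ρ : Measure (ℝ × ℝ), ∀ S, MeasurableSet S →
        (ρ.restrict (Prod.fst ⁻¹' Ici x)).map Prod.snd S = ρ (Ici x ×ˢ S) := fun ρ S hS => by
      rw [Measure.map_apply measurable_snd hS, Measure.restrict_apply (measurable_snd hS),
        inter_comm, Set.prod_eq]
    have := Measure.ext_of_Iic ((μ.restrict (Prod.fst ⁻¹' Ici x)).map Prod.snd)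
      ((ν.restrict (Prod.fst ⁻¹' Ici x)).map Prod.snd) fun y => by
        rw [hm _ _ measurableSet_Iic, hm _ _ measurableSet_Iic, h']
    rw [← hm _ _ hT, ← hm _ _ hT, this]
  refine Measure.ext_prod fun {S T} hS hT => ?_
  have hm : ∀ ρ : Measure (ℝ × ℝ), ∀ S, MeasurableSet S →
      (ρ.restrict (Prod.snd ⁻¹' T)).map Prod.fst S = ρ (S ×ˢ T) := fun ρ S hS => by
    rw [Measure.map_apply measurable_fst hS, Measure.restrict_apply (measurable_fst hS), Set.prod_eq]
  have := Measure.ext_of_Ici ((μ.restrict (Prod.snd ⁻¹' T)).map Prod.fst)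
    ((ν.restrict (Prod.snd ⁻¹' T)).map Prod.fst) fun x => by
      rw [hm _ _ measurableSet_Ici, hm _ _ measurableSet_Ici, key x T hT]
  rw [← hm _ _ hS, ← hm _ _ hS, this]

theorem measure_fst_Ico_le (hμ : IsPermuton μ) (a b : ℝ) :
    μ (Prod.fst ⁻¹' Ico a b) ≤ ENNReal.ofReal (b - a) := by
  rw [hμ.measure_fst_preimage measurableSet_Ico, ← Real.volume_Ico]
  exact measure_mono inter_subset_left

theorem measure_snd_Ioc_le (hμ : IsPermuton μ) (a b : ℝ) :
    μ (Prod.snd ⁻¹' Ioc a b) ≤ ENNReal.ofReal (b - a) := by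
  rw [hμ.measure_snd_preimage measurableSet_Ioc, ← Real.volume_Ioc]
  exact measure_mono inter_subset_left

theorem measure_fst_Ico (hμ : IsPermuton μ) {a b : ℝ} (ha : 0 ≤ a) (hb : b ≤ 1) :
    μ (Prod.fst ⁻¹' Ico a b) = ENNReal.ofReal (b - a) := by
  rw [hμ.measure_fst_preimage measurableSet_Ico, ← Real.volume_Ico,
    inter_eq_left.2 (Ico_subset_Icc_self.trans (Icc_subset_Icc ha hb))]

theorem measure_snd_Ioc (hμ : IsPermuton μ) {a b : ℝ} (ha : 0 ≤ a) (hb : b ≤ 1) :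
    μ (Prod.snd ⁻¹' Ioc a b) = ENNReal.ofReal (b - a) := by
  rw [hμ.measure_snd_preimage measurableSet_Ioc, ← Real.volume_Ioc,
    inter_eq_left.2 (Ioc_subset_Icc_self.trans (Icc_subset_Icc ha hb))]

/-- If a quadrant with corner `p` is null, then the mass of any other quadrant is at most the
mass of the strips separating their corners. -/
theorem measure_quadrant_le_stripBound (hμ : IsPermuton μ) {p : ℝ × ℝ}
    (hp : μ (Ici p.1 ×ˢ Iic p.2) = 0) (x y : ℝ) :
    μ (Ici x ×ˢ Iic y) ≤ ENNReal.ofReal (stripBound p x y) := by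
  have hsub : Ici x ×ˢ Iic y ⊆
      (Ici p.1 ×ˢ Iic p.2) ∪ (Prod.fst ⁻¹' Ico x p.1 ∪ Prod.snd ⁻¹' Ioc p.2 y) := by
    rintro ⟨s, t⟩ ⟨hs, ht⟩
    simp only [mem_Ici, mem_Iic, mem_union, mem_prod, mem_preimage, mem_Ico, mem_Ioc] at *
    grind
  refine (measure_mono hsub).trans ((measure_union_le _ _).trans ?_)
  rw [hp, zero_add, stripBound, ENNReal.ofReal_add (le_max_right _ _) (le_max_right _ _)]
  refine (measure_union_le _ _).trans (add_le_add ?_ ?_)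
  · exact (hμ.measure_fst_Ico_le _ _).trans (ENNReal.ofReal_le_ofReal (le_max_left _ _))
  · exact (hμ.measure_snd_Ioc_le _ _).trans (ENNReal.ofReal_le_ofReal (le_max_left _ _))

end IsPermuton

theorem PermutonAvoids231.measure_eq_zero {μ : Measure (ℝ × ℝ)} [SFinite μ]
    (h : PermutonAvoids231 μ) {A B C : Set (ℝ × ℝ)}
    (hABC : ∀ a ∈ A, ∀ b ∈ B, ∀ c ∈ C, a.1 < b.1 ∧ b.1 < c.1 ∧ c.2 < a.2 ∧ a.2 < b.2) :
    μ A = 0 ∨ μ B = 0 ∨ μ C = 0 := by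
  have h0 : (μ.prod (μ.prod μ)) (A ×ˢ B ×ˢ C) = 0 := measure_mono_null
    (fun t ht => hABC t.1 ht.1 t.2.1 ht.2.1 t.2.2 ht.2.2) h
  simpa [Measure.prod_prod] using h0

/-- The functions on `[0,1]` (extended by constancy to the line) that occur as RLM curves. -/
structure IsRLMFunction (f : ℝ → ℝ) : Prop where
  mono : Monotone f
  rightCont : ∀ x : ℝ, ContinuousWithinAt f (Ici x) x
  le_self : ∀ x ∈ Icc (0 : ℝ) 1, f x ≤ x
  nonneg : ∀ x, 0 ≤ f x
  one : f 1 = 1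

namespace IsRLMFunction

variable {f : ℝ → ℝ} {x y : ℝ}

theorem le_one (hf : IsRLMFunction f) (hx : x ∈ Icc (0 : ℝ) 1) : f x ≤ 1 :=
  (hf.le_self x hx).trans hx.2

theorem mk_mem_completedGraph (hf : IsRLMFunction f) (hx : x ∈ Icc (0 : ℝ) 1) :
    (x, f x) ∈ completedGraph f :=
  ⟨hx, hf.mono.leftLim_le le_rfl, le_rfl⟩

theorem completedGraph_nonempty (hf : IsRLMFunction f) : (completedGraph f).Nonempty :=
  ⟨_, hf.mk_mem_completedGraph (x := 1) ⟨zero_le_one, le_rfl⟩⟩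

theorem one_one_mem (hf : IsRLMFunction f) : ((1 : ℝ), (1 : ℝ)) ∈ completedGraph f := by
  have := hf.mk_mem_completedGraph (x := 1) ⟨zero_le_one, le_rfl⟩
  rwa [hf.one] at this

theorem zero_zero_mem (hf : IsRLMFunction f) : ((0 : ℝ), (0 : ℝ)) ∈ completedGraph f := by
  have h0 : (0 : ℝ) ∈ Icc (0 : ℝ) 1 := ⟨le_rfl, zero_le_one⟩
  have := hf.mk_mem_completedGraph h0
  rwa [le_antisymm (hf.le_self 0 h0) (hf.nonneg 0)] at this

theorem completedGraph_chain (hf : IsRLMFunction f) :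
    ∀ p ∈ completedGraph f, ∀ q ∈ completedGraph f, p ≤ q ∨ q ≤ p := by
  rintro ⟨a, b⟩ ⟨-, hb⟩ ⟨c, d⟩ ⟨-, hd⟩
  rcases lt_trichotomy a c with h | h | h
  · exact Or.inl ⟨h.le, hb.2.trans ((hf.mono.le_leftLim h).trans hd.1)⟩
  · exact (le_total b d).imp (fun h' => ⟨h.le, h'⟩) (fun h' => ⟨h.ge, h'⟩)
  · exact Or.inr ⟨h.le, hd.2.trans ((hf.mono.le_leftLim h).trans hb.1)⟩

theorem snd_nonneg (hf : IsRLMFunction f) {p : ℝ × ℝ} (hp : p ∈ completedGraph f) : 0 ≤ p.2 :=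
  ((hf.nonneg _).trans (hf.mono.le_leftLim (sub_one_lt p.1))).trans hp.2.1

theorem snd_le_fst (hf : IsRLMFunction f) {p : ℝ × ℝ} (hp : p ∈ completedGraph f) :
    p.2 ≤ p.1 :=
  hp.2.2.trans (hf.le_self _ hp.1)

/-- The completed graph crosses every height above `f x` to the right of `x`. -/
theorem exists_crossing (hf : IsRLMFunction f) (hx : x ∈ Icc (0 : ℝ) 1) (hxy : f x < y)
    (hy : y ≤ 1) :
    ∃ z, x ≤ z ∧ z ≤ 1 ∧ (z, y) ∈ completedGraph f ∧ ∀ s, s < z ↔ f s < y := by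
  set S := {s | y ≤ f s} with hS
  have h1 : (1 : ℝ) ∈ S := by rw [hS, mem_ofPred_eq, hf.one]; exact hy
  have hlow : ∀ s ∈ S, x ≤ s := fun s hs => le_of_not_gt fun h =>
    absurd ((hf.mono h.le).trans_lt hxy) (not_lt.2 hs)
  have hbdd : BddBelow S := ⟨x, hlow⟩
  have hlt : ∀ s, s < sInf S → f s < y := fun s hs =>
    not_le.1 fun h => notMem_of_lt_csInf hs hbdd h
  have hz : y ≤ f (sInf S) := by
    by_contra! h
    have := (hf.rightCont (sInf S)).eventually_lt_const h
    obtain ⟨u, hu, hu'⟩ := mem_nhdsGE_iff_exists_Ico_subset.1 this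
    obtain ⟨s, hs, hsu⟩ := exists_lt_of_csInf_lt ⟨1, h1⟩ (mem_Ioi.1 hu)
    have hsy : f s < y := hu' ⟨csInf_le hbdd hs, hsu⟩
    exact absurd hsy (not_lt.2 hs)
  refine ⟨sInf S, le_csInf ⟨1, h1⟩ hlow, csInf_le hbdd h1,
    ⟨⟨hx.1.trans (le_csInf ⟨1, h1⟩ hlow), csInf_le hbdd h1⟩, ?_, hz⟩, fun s => ⟨hlt s, fun h => ?_⟩⟩
  · refine le_of_tendsto (hf.mono.tendsto_leftLim (sInf S)) ?_
    filter_upwards [self_mem_nhdsWithin] with s hs using (hlt s hs).le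
  · exact not_le.1 fun h' => absurd (hz.trans (hf.mono h')) (not_le.2 h)

theorem infStripBound_eq_zero (hf : IsRLMFunction f) (hx : x ∈ Icc (0 : ℝ) 1) (hy : y ≤ f x) :
    infStripBound (completedGraph f) x y = 0 := by
  refine le_antisymm ?_ (infStripBound_nonneg hf.completedGraph_nonempty _ _)
  refine (infStripBound_le (hf.mk_mem_completedGraph hx) x y).trans ?_
  simp [stripBound, hy]

theorem infStripBound_pos (hf : IsRLMFunction f) (hy : f x < y) :
    0 < infStripBound (completedGraph f) x y := by
  obtain ⟨c, hc, hcy⟩ := exists_between hy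
  obtain ⟨u, hu, hu'⟩ := mem_nhdsGE_iff_exists_Ico_subset.1
    ((hf.rightCont x).eventually_lt_const hc)
  have hxu : x < u := hu
  have hpos : 0 < min (u - x) (y - c) := lt_min (by linarith) (by linarith)
  refine hpos.trans_le (le_infStripBound hf.completedGraph_nonempty fun p hp => ?_)
  unfold stripBound
  rcases le_or_gt u p.1 with h | h
  · linarith [min_le_left (u - x) (y - c), le_max_left (p.1 - x) 0, le_max_right (y - p.2) 0]
  · have hpc : p.2 ≤ c := by
      refine hp.2.2.trans ?_
      rcases le_or_gt x p.1 with h' | h'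
      · exact (hu' ⟨h', h⟩ : f p.1 < c).le
      · exact (hf.mono h'.le).trans hc.le
    linarith [min_le_right (u - x) (y - c), le_max_right (p.1 - x) 0, le_max_left (y - p.2) 0]

theorem infStripBound_zero_right (hf : IsRLMFunction f) (hx : x ∈ Icc (0 : ℝ) 1) :
    infStripBound (completedGraph f) x 0 = 0 :=
  hf.infStripBound_eq_zero hx (hf.nonneg x)

theorem infStripBound_one_left (hf : IsRLMFunction f) (hy : y ≤ 1) :
    infStripBound (completedGraph f) 1 y = 0 :=
  hf.infStripBound_eq_zero ⟨zero_le_one, le_rfl⟩ (by rwa [hf.one])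

theorem infStripBound_zero_left (hf : IsRLMFunction f) (hy : 0 ≤ y) :
    infStripBound (completedGraph f) 0 y = y := by
  refine le_antisymm ?_ (le_infStripBound hf.completedGraph_nonempty fun p hp => ?_)
  · refine (infStripBound_le hf.zero_zero_mem 0 y).trans ?_
    simp [stripBound, hy]
  · unfold stripBound
    linarith [hf.snd_le_fst hp, le_max_left (p.1 - 0) 0, le_max_left (y - p.2) 0]

theorem infStripBound_one_right (hf : IsRLMFunction f) (hx : x ≤ 1) :
    infStripBound (completedGraph f) x 1 = 1 - x := by
  refine le_antisymm ?_ (le_infStripBound hf.completedGraph_nonempty fun p hp => ?_)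
  · refine (infStripBound_le hf.one_one_mem x 1).trans ?_
    simp [stripBound, hx]
  · unfold stripBound
    linarith [hf.snd_le_fst hp, le_max_left (p.1 - x) 0, le_max_left (1 - p.2) 0]

theorem Pfun_eq_infStripBound (hf : IsRLMFunction f) (hx : x ∈ Icc (0 : ℝ) 1) (hy : y ≤ 1) :
    Pfun f x y = infStripBound (completedGraph f) x y := by
  unfold Pfun
  split_ifs with h
  · have hbound : ∀ p ∈ graphPart f x y, stripBound p x y = y - x + (p.1 - p.2) := fun p hp => by
      rw [stripBound, max_eq_left (sub_nonneg.2 hp.2.1.1), max_eq_left (sub_nonneg.2 hp.2.2.2)]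
      ring
    have hxf : (x, f x) ∈ graphPart f x y :=
      ⟨hf.mk_mem_completedGraph hx, ⟨le_rfl, hx.2⟩, hf.nonneg x, h⟩
    have hbdd : BddBelow ((fun p : ℝ × ℝ => p.1 - p.2) '' graphPart f x y) := by
      refine ⟨0, ?_⟩
      rintro _ ⟨p, hp, rfl⟩
      exact sub_nonneg.2 (hf.snd_le_fst hp.1)
    have hle : ∀ p ∈ graphPart f x y,
        y - x + sInf ((fun p : ℝ × ℝ => p.1 - p.2) '' graphPart f x y) ≤ stripBound p x y :=
      fun p hp => by
        rw [hbound p hp]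
        linarith [csInf_le hbdd (mem_image_of_mem (fun p : ℝ × ℝ => p.1 - p.2) hp)]
    refine le_antisymm (le_infStripBound hf.completedGraph_nonempty fun p hp => ?_) ?_
    · rcases lt_or_ge p.1 x with h1 | h1
      · refine (hle _ hxf).trans ?_
        have : p.2 ≤ f x := hp.2.2.trans (hf.mono h1.le)
        unfold stripBound
        simp only [sub_self, max_self]
        gcongr
        exact le_max_right _ _
      rcases le_or_gt p.2 y with h2 | h2
      · exact hle p ⟨hp, ⟨h1, hp.1.2⟩, hf.snd_nonneg hp, h2⟩
      obtain ⟨z, hxz, hz1, hzG, hzp⟩ : ∃ z, x ≤ z ∧ z ≤ 1 ∧ (z, y) ∈ completedGraph f ∧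
          z ≤ p.1 := by
        rcases h.eq_or_lt with h3 | h3
        · exact ⟨x, le_rfl, hx.2, h3 ▸ hf.mk_mem_completedGraph hx, h1⟩
        · obtain ⟨z, hz0, hz1, hz2, hz3⟩ := hf.exists_crossing hx h3 hy
          exact ⟨z, hz0, hz1, hz2, not_lt.1 fun hlt =>
            absurd (h2.trans_le hp.2.2) ((hz3 p.1).1 hlt).not_gt⟩
      refine (hle (z, y) ⟨hzG, ⟨hxz, hz1⟩, hf.snd_nonneg hzG, le_rfl⟩).trans ?_
      unfold stripBound
      simp only [sub_self, max_self]
      gcongr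
      exact le_max_right _ _
    · rw [← sub_le_iff_le_add']
      refine le_csInf ⟨_, mem_image_of_mem _ hxf⟩ ?_
      rintro _ ⟨p, hp, rfl⟩
      have h1 := infStripBound_le hp.1 x y
      rw [hbound p hp] at h1
      dsimp only
      linarith
  · exact (hf.infStripBound_eq_zero hx (not_le.1 h).le).symm

theorem exists_permuton (hf : IsRLMFunction f) :
    ∃ μ : Measure (ℝ × ℝ), IsPermuton μ ∧ ∀ x ∈ Icc (0 : ℝ) 1, ∀ y ∈ Icc (0 : ℝ) 1,
      μ (Ici x ×ˢ Iic y) = ENNReal.ofReal (infStripBound (completedGraph f) x y) := by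
  set c : ℝ → ℝ := fun t => max 0 (min t 1) with hc
  have hc01 : ∀ t, c t ∈ Icc (0 : ℝ) 1 := fun t =>
    ⟨le_max_left _ _, max_le zero_le_one (min_le_right _ _)⟩
  have hc0 : ∀ t ≤ 0, c t = 0 := fun t ht => max_eq_left ((min_le_left _ _).trans ht)
  have hc1 : ∀ t, 1 ≤ t → c t = 1 := fun t ht => by simp [hc, min_eq_right ht]
  have hcid : ∀ t ∈ Icc (0 : ℝ) 1, c t = t := fun t ht => by
    simp [hc, min_eq_left ht.2, max_eq_right ht.1]
  have hcmono : Monotone c := fun s t h => max_le_max le_rfl (min_le_min h le_rfl)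
  have hclip : ∀ s t, |c s - c t| ≤ |s - t| := fun s t => by
    refine (abs_max_sub_max_le_max 0 (min s 1) 0 (min t 1)).trans (max_le (by simp) ?_)
    exact (abs_min_sub_min_le_max s 1 t 1).trans (max_le le_rfl (by simp))
  have hG := hf.completedGraph_nonempty
  obtain ⟨μ, hμ, hμC⟩ := exists_measure_quadrant_eq
    (C := fun x y => infStripBound (completedGraph f) (c x) (c y))
    (fun x x' y y' hx hy => infStripBound_two_increasing hG hf.completedGraph_chain
      (hcmono hx) (hcmono hy))
    (fun x x' y y' => (abs_infStripBound_sub_le hG _ _ _ _).trans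
      (add_le_add (hclip _ _) (hclip _ _)))
    (fun x y hx => by rw [hc1 x hx]; exact hf.infStripBound_one_left (hc01 y).2)
    (fun x y hy => by rw [hc0 y hy]; exact hf.infStripBound_zero_right (hc01 x))
    (fun x y hx => by rw [hc0 x hx, hc0 0 le_rfl])
    (fun x y hy => by rw [hc1 y hy, hc1 1 le_rfl])
    (by rw [hc0 0 le_rfl, hc1 1 le_rfl, hf.infStripBound_zero_left zero_le_one])
  have hae : ∀ᵐ p ∂μ, p ∈ Ici (0 : ℝ) ×ˢ Iic (1 : ℝ) := by
    refine (mem_ae_iff_prob_eq_one (measurableSet_Ici.prod measurableSet_Iic)).2 ?_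
    rw [hμC, hc0 0 le_rfl, hc1 1 le_rfl, hf.infStripBound_zero_left zero_le_one,
      ENNReal.ofReal_one]
  refine ⟨μ, ⟨hμ, ?_, ?_⟩, fun x hx y hy => ?_⟩
  · refine Measure.ext_of_Ici _ _ fun x => ?_
    have h1 : μ (Prod.fst ⁻¹' Ici x) = μ (Ici x ×ˢ Iic 1) := by
      refine measure_congr ?_
      filter_upwards [hae] with p hp
      exact propext ⟨fun h => ⟨h, hp.2⟩, fun h => h.1⟩
    rw [Measure.map_apply measurable_fst measurableSet_Ici, h1, hμC, hc1 1 le_rfl,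
      hf.infStripBound_one_right (hc01 x).2, Measure.restrict_apply measurableSet_Ici,
      show Ici x ∩ Icc 0 1 = Icc (max 0 x) 1 by ext t; simp; tauto, Real.volume_Icc]
    rcases le_total x 1 with h | h
    · simp [hc, min_eq_left h]
    · rw [hc1 x h, ENNReal.ofReal_of_nonpos (by simp), ENNReal.ofReal_of_nonpos (by simp [h])]
  · refine Measure.ext_of_Iic _ _ fun y => ?_
    have h1 : μ (Prod.snd ⁻¹' Iic y) = μ (Ici 0 ×ˢ Iic y) := by
      refine measure_congr ?_
      filter_upwards [hae] with p hp
      exact propext ⟨fun h => ⟨hp.1, h⟩, fun h => h.2⟩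
    rw [Measure.map_apply measurable_snd measurableSet_Iic, h1, hμC, hc0 0 le_rfl,
      hf.infStripBound_zero_left (hc01 y).1, Measure.restrict_apply measurableSet_Iic,
      show Iic y ∩ Icc 0 1 = Icc 0 (min y 1) by ext t; simp; tauto, Real.volume_Icc]
    simp [hc]
  · rw [hμC, hcid x hx, hcid y hy]

theorem RLMcurve_eq (hf : IsRLMFunction f) {μ : Measure (ℝ × ℝ)} (hμ : IsPermuton μ)
    (hμf : ∀ x ∈ Icc (0 : ℝ) 1, ∀ y ∈ Icc (0 : ℝ) 1,
      μ (Ici x ×ˢ Iic y) = ENNReal.ofReal (infStripBound (completedGraph f) x y))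
    (hx : x ∈ Icc (0 : ℝ) 1) : RLMcurve μ x = f x := by
  refine IsGreatest.csSup_eq ⟨⟨⟨hf.nonneg x, hf.le_one hx⟩, ?_⟩, fun y hy => ?_⟩
  · rw [hμ.measure_Icc_prod_Icc, hμf x hx _ ⟨hf.nonneg x, hf.le_one hx⟩,
      hf.infStripBound_eq_zero hx le_rfl, ENNReal.ofReal_zero]
  · by_contra! h
    have h0 := hy.2
    rw [hμ.measure_Icc_prod_Icc, hμf x hx y hy.1, ENNReal.ofReal_eq_zero] at h0
    exact absurd (hf.infStripBound_pos h) (not_lt.2 h0)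

end IsRLMFunction

namespace IsPermuton

theorem avoids231 {μ : Measure (ℝ × ℝ)} (hμ : IsPermuton μ) {G : Set (ℝ × ℝ)}
    (hG : G.Nonempty)
    (hμG : ∀ x ∈ Icc (0 : ℝ) 1, ∀ y ∈ Icc (0 : ℝ) 1,
      μ (Ici x ×ˢ Iic y) = ENNReal.ofReal (infStripBound G x y)) :
    PermutonAvoids231 μ := by
  have := hμ.1
  have key : ∀ p q v w : ℝ, μ (Iio p ×ˢ Ioc v w) = 0 ∨ μ (Ico p q ×ˢ Ioi w) = 0 ∨
      μ (Ici q ×ˢ Iic v) = 0 := by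
    intro p q v w
    by_contra! hne
    obtain ⟨hA, hB, hC⟩ := hne
    have hae : ∀ S : Set (ℝ × ℝ), μ S ≠ 0 →
        ∃ r ∈ S, r.1 ∈ Ioo (0 : ℝ) 1 ∧ r.2 ∈ Ioo (0 : ℝ) 1 := fun S hS => by
      by_contra! h
      refine hS (measure_mono_null (fun r hr => ?_) (ae_iff.1 hμ.ae_mem_Ioo))
      exact fun hr' => h r hr hr'.1 hr'.2
    obtain ⟨a, ⟨ha1, ha2, ha3⟩, ha4, ha5⟩ := hae _ hA
    obtain ⟨b, ⟨⟨hb1, hb2⟩, hb3⟩, hb4, hb5⟩ := hae _ hB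
    obtain ⟨d, ⟨hd1, hd2⟩, hd4, hd5⟩ := hae _ hC
    simp only [mem_Iio, mem_Ici, mem_Iic, mem_Ioi, mem_Ioo] at *
    have hp : p ∈ Icc (0 : ℝ) 1 := ⟨by linarith, by linarith⟩
    have hq : q ∈ Icc (0 : ℝ) 1 := ⟨by linarith, by linarith⟩
    have hv : v ∈ Icc (0 : ℝ) 1 := ⟨by linarith, by linarith⟩
    have hw : w ∈ Icc (0 : ℝ) 1 := ⟨by linarith, by linarith⟩
    have hpos : 0 < infStripBound G q v := by
      rw [hμG q hq v hv] at hC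
      exact not_le.1 fun h => hC (ENNReal.ofReal_of_nonpos h)
    have hcancel : ∀ {S : Set (ℝ × ℝ)}, MeasurableSet S → Disjoint (Ici p ×ˢ Iic w) S →
        μ (Ici p ×ˢ Iic w ∪ S) ≤ μ (Ici p ×ˢ Iic w) → μ S = 0 := fun hS hd hle => by
      rw [measure_union hd hS] at hle
      exact nonpos_iff_eq_zero.1 ((ENNReal.add_le_add_iff_left (measure_ne_top μ _)).1
        (hle.trans_eq (add_zero _).symm))
    rcases min_le_iff.1 (min_le_infStripBound hG (hb1.trans hb2.le) (ha2.le.trans ha3) hpos)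
      with h | h
    · refine hA (hcancel (measurableSet_Iio.prod measurableSet_Ioc) ?_ ?_)
      · exact Set.disjoint_left.2 fun r hr hr' => absurd (mem_Iio.1 hr'.1) (not_lt.2 hr.1)
      · calc μ (Ici p ×ˢ Iic w ∪ Iio p ×ˢ Ioc v w)
            ≤ μ (Ici p ×ˢ Iic v ∪ Prod.snd ⁻¹' Ioc v w) := measure_mono fun r hr => by
              simp only [mem_union, mem_prod, mem_Ici, mem_Iic, mem_Iio, mem_Ioc,
                mem_preimage] at hr ⊢
              grind
          _ ≤ ENNReal.ofReal (infStripBound G p v) + ENNReal.ofReal (w - v) :=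
              (measure_union_le _ _).trans (add_le_add (hμG p hp v hv).le
                (hμ.measure_snd_Ioc_le v w))
          _ ≤ μ (Ici p ×ˢ Iic w) := by
              rw [← ENNReal.ofReal_add (infStripBound_nonneg hG _ _) (by linarith),
                hμG p hp w hw]
              exact ENNReal.ofReal_le_ofReal h
    · refine hB (hcancel (measurableSet_Ico.prod measurableSet_Ioi) ?_ ?_)
      · exact Set.disjoint_left.2 fun r hr hr' => absurd (mem_Ioi.1 hr'.2) (not_lt.2 hr.2)
      · calc μ (Ici p ×ˢ Iic w ∪ Ico p q ×ˢ Ioi w)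
            ≤ μ (Ici q ×ˢ Iic w ∪ Prod.fst ⁻¹' Ico p q) := measure_mono fun r hr => by
              simp only [mem_union, mem_prod, mem_Ici, mem_Iic, mem_Ioi, mem_Ico,
                mem_preimage] at hr ⊢
              grind
          _ ≤ ENNReal.ofReal (infStripBound G q w) + ENNReal.ofReal (q - p) :=
              (measure_union_le _ _).trans (add_le_add (hμG q hq w hw).le
                (hμ.measure_fst_Ico_le p q))
          _ ≤ μ (Ici p ×ˢ Iic w) := by
              rw [← ENNReal.ofReal_add (infStripBound_nonneg hG _ _) (by linarith),
                hμG p hp w hw]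
              exact ENNReal.ofReal_le_ofReal h
  refine measure_mono_null (t := ⋃ (p : ℚ) (q : ℚ) (v : ℚ) (w : ℚ),
    (Iio (p : ℝ) ×ˢ Ioc (v : ℝ) w) ×ˢ (Ico (p : ℝ) q ×ˢ Ioi (w : ℝ)) ×ˢ
      (Ici (q : ℝ) ×ˢ Iic (v : ℝ))) ?_ ?_
  · rintro ⟨a, b, d⟩ ⟨h1, h2, h3, h4⟩
    obtain ⟨p, hp1, hp2⟩ := exists_rat_btwn h1
    obtain ⟨q, hq1, hq2⟩ := exists_rat_btwn h2
    obtain ⟨v, hv1, hv2⟩ := exists_rat_btwn h3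
    obtain ⟨w, hw1, hw2⟩ := exists_rat_btwn h4
    simp only [mem_iUnion]
    exact ⟨p, q, v, w, ⟨hp1, hv2, hw1.le⟩, ⟨⟨hp2.le, hq1⟩, hw2⟩, hq2.le, hv1.le⟩
  · simp only [measure_iUnion_null_iff]
    intro p q v w
    rw [Measure.prod_prod, Measure.prod_prod, mul_eq_zero, mul_eq_zero]
    exact key p q v w

end IsPermuton

/-- A set covered by a null set and strips of arbitrarily small mass is null. -/
theorem measure_eq_zero_of_forall_le_ofReal {α : Type*} [MeasurableSpace α] {μ : Measure α}
    {S : Set α} (h : ∀ ε : ℝ, 0 < ε → μ S ≤ ENNReal.ofReal ε) : μ S = 0 :=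
  nonpos_iff_eq_zero.1 (ENNReal.le_of_forall_pos_le_add fun ε hε _ => by
    simpa using h ε hε)

theorem IsRLMFunction.measure_quadrant_eq {f : ℝ → ℝ} (hf : IsRLMFunction f)
    {ν : Measure (ℝ × ℝ)} (hν : IsPermuton ν) (hav : PermutonAvoids231 ν)
    (hR : ∀ x ∈ Icc (0 : ℝ) 1, RLMcurve ν x = f x) {x y : ℝ} (hx : x ∈ Icc (0 : ℝ) 1)
    (hy : y ∈ Icc (0 : ℝ) 1) :
    ν (Ici x ×ˢ Iic y) = ENNReal.ofReal (infStripBound (completedGraph f) x y) := by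
  have := hν.1
  have hpos : ∀ s ∈ Icc (0 : ℝ) 1, ∀ t ∈ Icc (0 : ℝ) 1, f s < t → ν (Ici s ×ˢ Iic t) ≠ 0 := by
    intro s hs t ht hst h0
    rw [← hν.measure_Icc_prod_Icc] at h0
    refine absurd hst (not_lt.2 ?_)
    rw [← hR s hs]
    exact le_csSup ⟨1, fun y hy => hy.1.2⟩ ⟨ht, h0⟩
  have hlt : ∀ s ∈ Icc (0 : ℝ) 1, ∀ t < f s, ν (Ici s ×ˢ Iic t) = 0 := by
    intro s hs t ht
    rw [← hR s hs] at ht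
    have h0 : ν (Icc s 1 ×ˢ Icc 0 0) = 0 := by
      rw [hν.measure_Icc_prod_Icc]
      refine measure_mono_null (fun r hr => ?_) (ae_iff.1 hν.ae_mem_Ioo)
      exact fun h => absurd h.2.1 (not_lt.2 hr.2)
    obtain ⟨u, hu, htu⟩ := exists_lt_of_lt_csSup
      (⟨0, ⟨le_rfl, zero_le_one⟩, h0⟩ : {y : ℝ | y ∈ Icc (0 : ℝ) 1 ∧
        ν (Icc s 1 ×ˢ Icc 0 y) = 0}.Nonempty) ht
    refine measure_mono_null (Set.prod_mono subset_rfl (Iic_subset_Iic.2 htu.le)) ?_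
    rw [← hν.measure_Icc_prod_Icc]
    exact hu.2
  have hnull : ∀ p ∈ completedGraph f, ν (Ici p.1 ×ˢ Iic p.2) = 0 := by
    intro p hp
    refine measure_eq_zero_of_forall_le_ofReal fun ε hε => ?_
    refine (hν.measure_quadrant_le_stripBound (p := (p.1, p.2 - ε)) (hlt _ hp.1 _ ?_) _ _).trans ?_
    · linarith [hp.2.2]
    · refine ENNReal.ofReal_le_ofReal ?_
      simp [stripBound, hε.le]
  refine le_antisymm ?_ ?_
  · refine ENNReal.le_of_forall_pos_le_add fun ε hε _ => ?_
    obtain ⟨p, hp, hpε⟩ := exists_stripBound_lt hf.completedGraph_nonempty x y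
      (NNReal.coe_pos.2 hε)
    refine (hν.measure_quadrant_le_stripBound (hnull p hp) x y).trans ?_
    refine (ENNReal.ofReal_le_ofReal hpε.le).trans ?_
    rw [ENNReal.ofReal_add (infStripBound_nonneg hf.completedGraph_nonempty _ _) ε.coe_nonneg,
      ENNReal.ofReal_coe_nnreal]
  rcases le_or_gt y (f x) with hyf | hyf
  · rw [hf.infStripBound_eq_zero hx hyf]
    simp
  set S := {t | t ∈ Icc 0 y ∧ ν (Iio x ×ˢ Ioc t y) = 0} with hS
  have hyS : y ∈ S := ⟨⟨hy.1, le_rfl⟩, by simp⟩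
  have hbdd : BddBelow S := ⟨0, fun t ht => ht.1.1⟩
  set y' := sInf S with hy'
  have hy'y : y' ≤ y := csInf_le hbdd hyS
  have hy'0 : 0 ≤ y' := le_csInf ⟨y, hyS⟩ fun t ht => ht.1.1
  have hleft0 : ν (Iio x ×ˢ Ioc y' y) = 0 := by
    refine measure_eq_zero_of_forall_le_ofReal fun ε hε => ?_
    obtain ⟨t, ht, htε⟩ := exists_lt_of_csInf_lt ⟨y, hyS⟩ (lt_add_of_pos_right y' hε)
    calc ν (Iio x ×ˢ Ioc y' y) ≤ ν (Iio x ×ˢ Ioc t y ∪ Prod.snd ⁻¹' Ioc y' t) :=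
          measure_mono fun r hr => by
            simp only [mem_union, mem_prod, mem_Iio, mem_Ioc, mem_preimage] at hr ⊢
            grind
      _ ≤ 0 + ENNReal.ofReal (t - y') := (measure_union_le _ _).trans
          (add_le_add ht.2.le (hν.measure_snd_Ioc_le _ _))
      _ ≤ ENNReal.ofReal ε := by
          rw [zero_add]
          exact ENNReal.ofReal_le_ofReal (by linarith)
  have hleft : ∀ t, 0 ≤ t → t < y' → ν (Iio x ×ˢ Ioc t y') ≠ 0 := by
    intro t ht0 ht h0
    refine absurd (csInf_le hbdd (⟨⟨ht0, ht.le.trans hy'y⟩, ?_⟩ : t ∈ S)) (not_le.2 ht)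
    refine measure_mono_null (fun r hr => ?_) (measure_union_null h0 hleft0)
    simp only [mem_union, mem_prod, mem_Iio, mem_Ioc] at hr ⊢
    grind
  rcases le_or_gt y' (f x) with hcase | hcase
  · refine (ENNReal.ofReal_le_ofReal (infStripBound_le (hf.mk_mem_completedGraph hx) x y)).trans ?_
    rw [stripBound, sub_self, max_self, zero_add, max_eq_left (by linarith),
      ← hν.measure_snd_Ioc (hf.nonneg x) hy.2, ← zero_add (ν (Ici x ×ˢ Iic y)), ← hleft0]
    refine (measure_mono fun r hr => ?_).trans (measure_union_le _ _)
    simp only [mem_union, mem_prod, mem_Iio, mem_Ioc, mem_Ici, mem_Iic, mem_preimage] at hr ⊢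
    grind
  obtain ⟨z, hxz, hz1, hzG, hz⟩ := hf.exists_crossing hx hcase (hy'y.trans hy.2)
  have habove : ν (Ico x z ×ˢ Ioi y') = 0 := by
    have hs0 : ∀ s, x ≤ s → s < z → ν (Ico x s ×ˢ Ioi y') = 0 := by
      intro s hxs hsz
      obtain ⟨t, hst, hty'⟩ := exists_between ((hz s).1 hsz)
      have ht0 : 0 ≤ t := (hf.nonneg s).trans hst.le
      have h3 := hpos s ⟨hx.1.trans hxs, hsz.le.trans hz1⟩ t
        ⟨ht0, hty'.le.trans (hy'y.trans hy.2)⟩ hst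
      refine ((hav.measure_eq_zero (A := Iio x ×ˢ Ioc t y') (B := Ico x s ×ˢ Ioi y')
        (C := Ici s ×ˢ Iic t) ?_).resolve_left (hleft t ht0 hty')).resolve_right h3
      rintro a ⟨ha1, ha2, ha3⟩ b ⟨⟨hb1, hb2⟩, hb3⟩ d ⟨hd1, hd2⟩
      exact ⟨lt_of_lt_of_le ha1 hb1, lt_of_lt_of_le hb2 hd1, lt_of_le_of_lt hd2 ha2,
        lt_of_le_of_lt ha3 hb3⟩
    refine measure_eq_zero_of_forall_le_ofReal fun ε hε => ?_
    rcases hxz.eq_or_lt with rfl | hxz'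
    · simp
    calc ν (Ico x z ×ˢ Ioi y')
        ≤ ν (Ico x (max x (z - ε)) ×ˢ Ioi y' ∪ Prod.fst ⁻¹' Ico (max x (z - ε)) z) :=
          measure_mono fun r hr => by
            simp only [mem_union, mem_prod, mem_Ioi, mem_Ico, mem_preimage] at hr ⊢
            grind
      _ ≤ 0 + ENNReal.ofReal (z - max x (z - ε)) := (measure_union_le _ _).trans
          (add_le_add (hs0 _ (le_max_left _ _) (max_lt hxz' (by linarith))).le
            (hν.measure_fst_Ico_le _ _))
      _ ≤ ENNReal.ofReal ε := by
          rw [zero_add]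
          exact ENNReal.ofReal_le_ofReal (by linarith [le_max_right x (z - ε)])
  calc ENNReal.ofReal (infStripBound (completedGraph f) x y)
      ≤ ENNReal.ofReal (z - x) + ENNReal.ofReal (y - y') := by
        rw [← ENNReal.ofReal_add (by linarith) (by linarith)]
        refine ENNReal.ofReal_le_ofReal ((infStripBound_le hzG x y).trans ?_)
        rw [stripBound, max_eq_left (by linarith), max_eq_left (by linarith)]
    _ ≤ ν (Ico x z ×ˢ Iic y') + ν (Ici x ×ˢ Ioc y' y) := by
        rw [← hν.measure_fst_Ico hx.1 hz1, ← hν.measure_snd_Ioc hy'0 hy.2]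
        refine add_le_add ?_ ?_
        · rw [← add_zero (ν (Ico x z ×ˢ Iic y')), ← habove]
          refine (measure_mono fun r hr => ?_).trans (measure_union_le _ _)
          simp only [mem_union, mem_prod, mem_Ico, mem_Iic, mem_Ioi, mem_preimage] at hr ⊢
          grind
        · rw [← zero_add (ν (Ici x ×ˢ Ioc y' y)), ← hleft0]
          refine (measure_mono fun r hr => ?_).trans (measure_union_le _ _)
          simp only [mem_union, mem_prod, mem_Iio, mem_Ici, mem_Ioc, mem_preimage] at hr ⊢
          grind
    _ = ν (Ico x z ×ˢ Iic y' ∪ Ici x ×ˢ Ioc y' y) := by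
        refine (measure_union ?_ (measurableSet_Ici.prod measurableSet_Ioc)).symm
        exact Set.disjoint_left.2 fun r hr hr' => absurd hr'.2.1 (not_lt.2 hr.2)
    _ ≤ ν (Ici x ×ˢ Iic y) := measure_mono fun r hr => by
        simp only [mem_union, mem_prod, mem_Ico, mem_Iic, mem_Ici, mem_Ioc] at hr ⊢
        grind

/-- Construction and uniqueness of the `231`-avoiding permuton with a given RLM curve:
there is exactly one `231`-avoiding permuton `μ` with
`μ([x,1]×[0,y]) = P_f(x,y)`, and this `μ` is the unique `231`-avoiding permuton whose
RLM curve equals `f`. Here `f` is a nondecreasing càdlàg function `[0,1] → [0,1]`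
with `f(x) ≤ x` and `f(1) = 1` (extended to `ℝ` by constancy outside `[0,1]`). -/
theorem permuton231_from_RLM_curve (f : ℝ → ℝ)
    (hmono : Monotone f)
    (hcadlag : ∀ x : ℝ, ContinuousWithinAt f (Set.Ici x) x)
    (hrange : ∀ x ∈ Set.Icc (0:ℝ) 1, f x ∈ Set.Icc (0:ℝ) 1)
    (hle : ∀ x ∈ Set.Icc (0:ℝ) 1, f x ≤ x)
    (h1 : f 1 = 1)
    (hleft : ∀ x : ℝ, x ≤ 0 → f x = f 0)
    (hright : ∀ x : ℝ, 1 ≤ x → f x = 1) :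
    ∃ μ : Measure (ℝ × ℝ),
      (IsPermuton μ ∧ PermutonAvoids231 μ ∧
        ∀ x ∈ Set.Icc (0:ℝ) 1, ∀ y ∈ Set.Icc (0:ℝ) 1,
          μ (Set.Icc x 1 ×ˢ Set.Icc 0 y) = ENNReal.ofReal (Pfun f x y)) ∧
      (∀ ν : Measure (ℝ × ℝ),
        (IsPermuton ν ∧ PermutonAvoids231 ν ∧
          ∀ x ∈ Set.Icc (0:ℝ) 1, ∀ y ∈ Set.Icc (0:ℝ) 1,
            ν (Set.Icc x 1 ×ˢ Set.Icc 0 y) = ENNReal.ofReal (Pfun f x y)) → ν = μ) ∧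
      (∀ x ∈ Set.Icc (0:ℝ) 1, RLMcurve μ x = f x) ∧
      (∀ ν : Measure (ℝ × ℝ), IsPermuton ν → PermutonAvoids231 ν →
        (∀ x ∈ Set.Icc (0:ℝ) 1, RLMcurve ν x = f x) → ν = μ) := by
  have h0 : (0 : ℝ) ∈ Icc (0 : ℝ) 1 := ⟨le_rfl, zero_le_one⟩
  have hf : IsRLMFunction f := ⟨hmono, hcadlag, hle, fun x => by
    rcases le_total x 0 with h | h
    · rw [hleft x h]; exact (hrange 0 h0).1
    · exact (hrange 0 h0).1.trans (hmono h), h1⟩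
  obtain ⟨μ, hμ, hμf⟩ := hf.exists_permuton
  have hext : ∀ ν : Measure (ℝ × ℝ), IsPermuton ν →
      (∀ x ∈ Icc (0 : ℝ) 1, ∀ y ∈ Icc (0 : ℝ) 1, ν (Ici x ×ˢ Iic y) =
        ENNReal.ofReal (infStripBound (completedGraph f) x y)) → ν = μ := fun ν hν h =>
    hν.ext_quadrant hμ fun x hx y hy => (h x hx y hy).trans (hμf x hx y hy).symm
  refine ⟨μ, ⟨hμ, hμ.avoids231 hf.completedGraph_nonempty hμf, fun x hx y hy => ?_⟩, ?_,
    fun x hx => hf.RLMcurve_eq hμ hμf hx, fun ν hν hav hR =>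
      hext ν hν fun x hx y hy => hf.measure_quadrant_eq hν hav hR hx hy⟩
  · rw [hμ.measure_Icc_prod_Icc, hμf x hx y hy, hf.Pfun_eq_infStripBound hx hy.2]
  · rintro ν ⟨hν, -, h⟩
    refine hext ν hν fun x hx y hy => ?_
    rw [← hν.measure_Icc_prod_Icc, h x hx y hy, hf.Pfun_eq_infStripBound hx hy.2]

end
end
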